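/- arXiv:2308.03980 — 4 statements merged into one kernel-verified Lean document; each statement's English description precedes it below -/
import Mathlib

section
/- Let T be a forest with connected components T_1, …, T_m and F a forest with components F_1, …, F_r. If X_T = X_F, then m = r and there is a permutation τ of {1,…,m} such that X_{T_i} = X_{F_{τ(i)}} for all i. -/
open SimpleGraph

/-- Proper coloring for an edge set over `Sym2 V` (loops allowed): adjacent (or equal, for a
loop) endpoints must receive different colors. -/
def ProperCol {V : Type*} (E : Set (Sym2 V)) (k : V -> Nat) : Prop :=
  forall u v : V, s(u, v) ∈ E -> k u ≠ k v

/-- Weighted chromatic symmetric function `X_{(G,w)}` as a formal power series in the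
variables `x_0, x_1, …` : the coefficient of a monomial `d` is the number of proper
colorings whose total weight in color `i` is `d i` for every `i`. -/
noncomputable def csfW {V : Type*} (E : Set (Sym2 V)) (w : V -> Nat) : MvPowerSeries Nat Int :=
  fun d => (Nat.card {k : V -> Nat |
    ProperCol E k ∧ forall i : Nat, (∑ᶠ v ∈ {v : V | k v = i}, w v) = d i} : Int)

/-- Chromatic symmetric function `X_G` of a simple graph. -/
noncomputable def csf {V : Type*} (G : SimpleGraph V) : MvPowerSeries Nat Int :=
  csfW G.edgeSet (fun _ => 1)

lemma injective_of_surjective_ringEnd {R : Type*} [CommRing R] [IsNoetherianRing R] (φ : R →+* R)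
    (hφ : Function.Surjective φ) : Function.Injective φ := by
  have hmono : Monotone fun n : ℕ => RingHom.ker (φ ^ n) := by
    refine monotone_nat_of_le_succ fun n x hx => ?_
    rw [RingHom.mem_ker] at hx ⊢
    rw [pow_succ', RingHom.mul_def, RingHom.comp_apply, hx, map_zero]
  obtain ⟨n, hn⟩ := monotone_stabilizes_iff_noetherian.mpr ‹IsNoetherianRing R› ⟨_, hmono⟩
  rw [injective_iff_map_eq_zero]
  intro x hx
  have hsurj : Function.Surjective (φ ^ n) := by
    rw [RingHom.coe_pow]
    exact hφ.iterate n
  obtain ⟨y, rfl⟩ := hsurj x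
  have h1 : y ∈ RingHom.ker (φ ^ (n + 1)) := by
    rwa [RingHom.mem_ker, pow_succ', RingHom.mul_def, RingHom.comp_apply]
  have h2 := hn (n + 1) n.le_succ
  simp only [OrderHom.coe_mk] at h2
  rwa [← h2, RingHom.mem_ker] at h1

namespace MvPolynomial

lemma esymm_mem_range_aeval_psum (N k : ℕ) (hk : k ≤ N) :
    esymm (Fin N) ℚ k ∈
      (aeval (R := ℚ) fun i : Fin N => psum (Fin N) ℚ ((i : ℕ) + 1)).range := by
  induction k using Nat.strong_induction_on with
  | _ k ih =>
    rcases Nat.eq_zero_or_pos k with rfl | hpos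
    · rw [esymm_zero]
      exact one_mem _
    have hmem : (k : MvPolynomial (Fin N) ℚ) * esymm (Fin N) ℚ k ∈
        (aeval (R := ℚ) fun i : Fin N => psum (Fin N) ℚ ((i : ℕ) + 1)).range := by
      rw [mul_esymm_eq_sum]
      refine mul_mem (pow_mem (neg_mem (one_mem _)) _) (sum_mem fun a ha => ?_)
      rw [Finset.mem_filter, Finset.HasAntidiagonal.mem_antidiagonal] at ha
      refine mul_mem (mul_mem (pow_mem (neg_mem (one_mem _)) _) (ih _ ha.2 (by lia))) ?_
      refine ⟨X ⟨a.2 - 1, by lia⟩, ?_⟩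
      simp only [AlgHom.toRingHom_eq_coe, RingHom.coe_coe, aeval_X]
      congr 1
      lia
    have := Subalgebra.smul_mem _ hmem ((k : ℚ)⁻¹)
    rwa [← nsmul_eq_mul, ← Nat.cast_smul_eq_nsmul ℚ, smul_smul, inv_mul_cancel₀ (by positivity),
      one_smul] at this

lemma aeval_psum_fin_injective (N : ℕ) :
    Function.Injective (aeval (R := ℚ) fun i : Fin N => psum (Fin N) ℚ ((i : ℕ) + 1)) := by
  set φ := aeval (R := ℚ) fun i : Fin N => psum (Fin N) ℚ ((i : ℕ) + 1)
  let φ' : MvPolynomial (Fin N) ℚ →ₐ[ℚ] symmetricSubalgebra (Fin N) ℚ :=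
    aeval fun i => ⟨psum (Fin N) ℚ ((i : ℕ) + 1), psum_isSymmetric _ _ _⟩
  have hcomp : (symmetricSubalgebra (Fin N) ℚ).val.comp φ' = φ := by
    ext i : 1
    simp [φ', φ]
  let e := esymmAlgEquiv (Fin N) ℚ (Fintype.card_fin N)
  let ψ : MvPolynomial (Fin N) ℚ →ₐ[ℚ] MvPolynomial (Fin N) ℚ := e.symm.toAlgHom.comp φ'
  have hψ : Function.Surjective ψ := by
    rw [← AlgHom.range_eq_top, eq_top_iff, ← adjoin_range_X, Algebra.adjoin_le_iff]
    rintro _ ⟨i, rfl⟩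
    obtain ⟨p, hp⟩ := esymm_mem_range_aeval_psum N (i + 1) i.2
    refine ⟨p, ?_⟩
    have : φ' p = ⟨esymm (Fin N) ℚ (i + 1), esymm_isSymmetric _ _ _⟩ := by
      exact Subtype.ext ((DFunLike.congr_fun hcomp p).trans hp)
    simp only [ψ, AlgHom.toRingHom_eq_coe, RingHom.coe_coe, AlgHom.comp_apply, this]
    exact esymmAlgEquiv_symm_apply (R := ℚ) (Fintype.card_fin N) i
  have hinj := injective_of_surjective_ringEnd ψ.toRingHom hψ
  have hφ'inj : Function.Injective φ' := fun x y hxy => hinj (congrArg e.symm hxy)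
  rw [← hcomp]
  exact Subtype.val_injective.comp hφ'inj

/-- The specialization of the `i`-th variable to the power sum `p_{i+1}` in `N` variables. -/
noncomputable def powerSumEval (N : ℕ) : MvPolynomial ℕ ℤ →ₐ[ℤ] MvPolynomial (Fin N) ℤ :=
  aeval fun i => psum (Fin N) ℤ (i + 1)

lemma eq_zero_of_forall_powerSumEval (f : MvPolynomial ℕ ℤ)
    (hf : ∀ N, powerSumEval N f = 0) : f = 0 := by
  obtain ⟨N, hN⟩ : ∃ N, ∀ i ∈ f.vars, i < N :=
    ⟨f.vars.sup id + 1, fun i hi => Nat.lt_succ_of_le (Finset.le_sup (f := id) hi)⟩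
  obtain ⟨g, rfl⟩ := exists_rename_eq_of_vars_subset_range f (Fin.val : Fin N → ℕ)
    Fin.val_injective (fun i hi => ⟨⟨i, hN i hi⟩, rfl⟩)
  have h := hf N
  rw [powerSumEval, aeval_rename] at h
  have hmap : (map (Int.castRingHom ℚ)).comp
      (aeval (R := ℤ) ((fun i => psum (Fin N) ℤ (i + 1)) ∘ Fin.val)).toRingHom =
      (aeval (R := ℚ) fun i : Fin N => psum (Fin N) ℚ ((i : ℕ) + 1)).toRingHom.comp
        (map (Int.castRingHom ℚ)) := by
    ext i : 2
    · simp
    · simp [psum]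
  have h2 := DFunLike.congr_fun hmap g
  simp only [AlgHom.toRingHom_eq_coe, RingHom.comp_apply, RingHom.coe_coe, h, map_zero] at h2
  have h3 := (map_eq_zero_iff _ (aeval_psum_fin_injective N)).mp h2.symm
  have h4 := (map_eq_zero_iff _ (map_injective _ (Int.cast_injective (α := ℚ)))).mp h3
  rw [h4, map_zero]

lemma powerSumEval_ext {f g : MvPolynomial ℕ ℤ}
    (h : ∀ N, powerSumEval N f = powerSumEval N g) : f = g :=
  sub_eq_zero.mp <| eq_zero_of_forall_powerSumEval _ fun N => by rw [map_sub, h, sub_self]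

end MvPolynomial

lemma exists_equiv_of_map_univ_eq {α β γ : Type*} [Fintype α] [Fintype β] (f : α → γ) (g : β → γ)
    (h : Finset.univ.val.map f = Finset.univ.val.map g) : ∃ e : α ≃ β, ∀ a, f a = g (e a) := by
  classical
  have hcard (c : γ) : Nonempty ({a // f a = c} ≃ {b // g b = c}) := by
    have := congrArg (Multiset.count c) h
    simp only [Multiset.count_map, ← Finset.filter_val, Finset.card_val] at this
    refine ⟨Fintype.equivOfCardEq ?_⟩
    simpa [Fintype.card_subtype, eq_comm] using this
  let e (c : γ) := Classical.choice (hcard c)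
  refine ⟨(Equiv.sigmaFiberEquiv f).symm.trans ((Equiv.sigmaCongrRight e).trans
    (Equiv.sigmaFiberEquiv g)), fun a => ?_⟩
  exact ((e (f a)) ⟨a, rfl⟩).2.symm

namespace SimpleGraph

open MvPolynomial

/-- The chromatic symmetric polynomial of `G` in `N` variables. -/
noncomputable def chromSymmPoly {V : Type*} [Fintype V] (G : SimpleGraph V) (N : ℕ) :
    MvPolynomial (Fin N) ℤ := by
  classical
  exact ∑ k : V → Fin N with ∀ u v, G.Adj u v → k u ≠ k v, ∏ v, X (k v)

lemma coeff_chromSymmPoly {V : Type*} [Fintype V] (G : SimpleGraph V) (N : ℕ)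
    (d : Fin N →₀ ℕ) : (G.chromSymmPoly N).coeff d = csf G (d.mapDomain Fin.val) := by
  classical
  have hprod (k : V → Fin N) : ∏ v, (X (k v) : MvPolynomial (Fin N) ℤ) =
      monomial (∑ v, Finsupp.single (k v) 1) 1 := by
    rw [monomial_sum_one]
    rfl
  have hcontent (k : V → Fin N) : ∑ v, Finsupp.single (k v) 1 = d ↔
      ∀ i, (Finset.univ.filter fun v => k v = i).card = d i := by
    rw [Finsupp.ext_iff]
    refine forall_congr' fun i => ?_
    rw [Finsupp.finsetSum_apply]
    simp [Finsupp.single_apply]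
  have hcsf (k : V → ℕ) (i : ℕ) : (∑ᶠ v ∈ {v : V | k v = i}, 1) =
      (Finset.univ.filter fun v => k v = i).card := by
    rw [finsum_mem_eq_finite_toFinset_sum _ (Set.toFinite _), ← Finset.card_eq_sum_ones]
    congr 1
    ext
    simp
  have hval (k : V → Fin N) (i : Fin N) :
      (Finset.univ.filter fun v => (k v : ℕ) = i) = Finset.univ.filter fun v => k v = i := by
    simp [Fin.ext_iff]
  simp only [chromSymmPoly, coeff_sum, hprod, coeff_monomial, Finset.sum_boole, csf, csfW]
  rw [Finset.filter_filter, Nat.cast_inj, ← Fintype.card_subtype, ← Nat.card_eq_fintype_card]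
  refine Nat.card_congr (Equiv.ofBijective (fun k => ⟨fun v => (k.1 v : ℕ), ?_, ?_⟩) ⟨?_, ?_⟩)
  · exact fun u v huv h => k.2.1 u v huv (Fin.ext h)
  · intro i
    rw [hcsf]
    by_cases hi : i < N
    · have := (hcontent k.1).mp k.2.2 ⟨i, hi⟩
      rw [← hval] at this
      rw [this]
      exact (Finsupp.mapDomain_apply Fin.val_injective d ⟨i, hi⟩).symm
    · rw [Finsupp.mapDomain_of_notMem_range _ _ (by simpa using hi), Finset.card_eq_zero,
        Finset.filter_eq_empty_iff]
      rintro v - rfl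
      exact hi (k.1 v).2
  · intro k l hkl
    ext v
    exact congrFun (congrArg Subtype.val hkl) v
  · rintro ⟨k, hk, hkd⟩
    have hlt (v : V) : k v < N := by
      by_contra hv
      have := hkd (k v)
      rw [hcsf, Finsupp.mapDomain_of_notMem_range _ _ (by simpa using hv), Finset.card_eq_zero,
        Finset.filter_eq_empty_iff] at this
      exact this (Finset.mem_univ v) rfl
    refine ⟨⟨fun v => ⟨k v, hlt v⟩, fun u v huv h => hk u v huv (Fin.ext_iff.mp h), ?_⟩, rfl⟩
    rw [hcontent]
    intro i
    rw [← hval, ← hcsf k, hkd, Finsupp.mapDomain_apply Fin.val_injective]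

lemma csf_eq_csf_iff {V W : Type*} [Fintype V] [Fintype W] {G : SimpleGraph V}
    {H : SimpleGraph W} : csf G = csf H ↔ ∀ N, G.chromSymmPoly N = H.chromSymmPoly N := by
  refine ⟨fun h N => ?_, fun h => ?_⟩
  · ext d
    rw [coeff_chromSymmPoly, coeff_chromSymmPoly, h]
  · funext d
    obtain ⟨N, hN⟩ : ∃ N, ∀ i ∈ d.support, i < N :=
      ⟨d.support.sup id + 1, fun i hi => Nat.lt_succ_of_le (Finset.le_sup (f := id) hi)⟩
    have hd : (d.comapDomain Fin.val Fin.val_injective.injOn).mapDomain Fin.val = d :=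
      Finsupp.mapDomain_comapDomain _ Fin.val_injective d fun i hi => ⟨⟨i, hN i hi⟩, rfl⟩
    rw [← hd, ← coeff_chromSymmPoly, ← coeff_chromSymmPoly, h]

lemma chromSymmPoly_eq_prod_connectedComponent {V : Type*} [Fintype V] (G : SimpleGraph V)
    [Fintype G.ConnectedComponent] [∀ c : G.ConnectedComponent, Fintype c.supp] (N : ℕ) :
    G.chromSymmPoly N = ∏ c : G.ConnectedComponent, (G.induce c.supp).chromSymmPoly N := by
  classical
  simp only [chromSymmPoly]
  rw [Finset.prod_univ_sum]
  refine Finset.sum_nbij' (fun k c v => k v) (fun k v => k (G.connectedComponentMk v) ⟨v, rfl⟩)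
    ?_ ?_ ?_ ?_ ?_
  · intro k hk
    simp only [Finset.mem_filter, Finset.mem_univ, true_and, Fintype.mem_piFinset] at hk ⊢
    exact fun c u v huv => hk u v huv
  · intro k hk
    simp only [Finset.mem_filter, Finset.mem_univ, true_and, Fintype.mem_piFinset] at hk ⊢
    intro u v huv
    have hc : G.connectedComponentMk v = G.connectedComponentMk u :=
      ConnectedComponent.sound huv.symm.reachable
    have hcongr (c : G.ConnectedComponent) (hc : G.connectedComponentMk v = c) :
        k (G.connectedComponentMk v) ⟨v, rfl⟩ = k c ⟨v, hc⟩ := by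
      subst hc
      rfl
    have := hk (G.connectedComponentMk u) ⟨u, rfl⟩ ⟨v, hc⟩ huv
    rwa [← hcongr _ hc] at this
  · intro k _
    rfl
  · intro k _
    funext c v
    obtain ⟨v, rfl⟩ := v
    rfl
  · intro k _
    rw [← (Equiv.sigmaFiberEquiv G.connectedComponentMk).prod_comp, Fintype.prod_sigma]
    exact Finset.prod_congr rfl fun c _ => Finset.prod_equiv (Equiv.refl _) (by simp) fun _ _ => rfl

/-- The expansion of the chromatic symmetric function of `G` in power sums, where the `i`-th
variable stands for the power sum `p_{i+1}`. -/
noncomputable def powerSumExpansion {V : Type*} [Fintype V] (G : SimpleGraph V) :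
    MvPolynomial ℕ ℤ := by
  classical
  exact ∑ S ∈ G.edgeFinset.powerset, (-1) ^ S.card *
    ∏ c : (fromEdgeSet (S : Set (Sym2 V))).ConnectedComponent, X (Nat.card c.supp - 1)

lemma prod_connectedComponent_psum {V : Type*} [Fintype V] [DecidableEq V] (G : SimpleGraph V)
    [Fintype G.ConnectedComponent] (N : ℕ)
    [DecidablePred fun k : V → Fin N => ∀ u v, G.Adj u v → k u = k v] :
    ∏ c : G.ConnectedComponent, psum (Fin N) ℤ (Nat.card c.supp) =
      ∑ k ∈ Finset.univ.filter (fun k : V → Fin N => ∀ u v, G.Adj u v → k u = k v),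
        ∏ v, X (k v) := by
  classical
  simp only [psum]
  rw [Finset.prod_univ_sum]
  have hconst {k : V → Fin N} (hk : ∀ u v, G.Adj u v → k u = k v) {u v : V}
      (huv : G.Reachable u v) : k u = k v := by
    obtain ⟨p⟩ := huv
    induction p with
    | nil => rfl
    | cons h _ ih => exact (hk _ _ h).trans ih
  refine Finset.sum_bij (fun p _ v => p (G.connectedComponentMk v)) ?_ ?_ ?_ ?_
  · intro p _
    simp only [Finset.mem_filter, Finset.mem_univ, true_and]
    exact fun u v huv => congrArg p (ConnectedComponent.sound huv.reachable)
  · intro p _ q _ hpq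
    funext c
    exact c.ind fun v => congrFun hpq v
  · intro k hk
    simp only [Finset.mem_filter, Finset.mem_univ, true_and] at hk
    refine ⟨ConnectedComponent.lift k fun u v q _ => hconst hk q.reachable, by simp, ?_⟩
    funext v
    rfl
  · intro p _
    rw [← (Equiv.sigmaFiberEquiv G.connectedComponentMk).prod_comp, Fintype.prod_sigma]
    refine Finset.prod_congr rfl fun c _ => ?_
    rw [Finset.prod_congr rfl (g := fun _ => X (p c))]
    · rw [Finset.prod_const, Finset.card_univ, ← Nat.card_eq_fintype_card]
      rfl
    · rintro ⟨v, rfl⟩ _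
      rfl

lemma powerSumEval_powerSumExpansion {V : Type*} [Fintype V] (G : SimpleGraph V) (N : ℕ) :
    powerSumEval N G.powerSumExpansion = G.chromSymmPoly N := by
  classical
  have hpow (S : Finset (Sym2 V)) (hS : S ∈ G.edgeFinset.powerset) :
      powerSumEval N ((-1) ^ S.card * ∏ c : (fromEdgeSet (S : Set (Sym2 V))).ConnectedComponent,
        X (Nat.card c.supp - 1)) =
      ∑ k : V → Fin N, ((-1) ^ S.card * ∏ e ∈ S, if (e.map k).IsDiag then 1 else 0) *
        ∏ v, X (k v) := by
    have hX (c : (fromEdgeSet (S : Set (Sym2 V))).ConnectedComponent) :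
        powerSumEval N (X (Nat.card c.supp - 1)) = psum (Fin N) ℤ (Nat.card c.supp) := by
      have : Nonempty c.supp := c.nonempty_supp.to_subtype
      rw [powerSumEval, aeval_X, Nat.sub_add_cancel Nat.card_pos]
    rw [map_mul, map_pow, map_neg, map_one, map_prod]
    simp only [hX, mul_assoc]
    rw [prod_connectedComponent_psum, ← Finset.mul_sum, Finset.sum_filter]
    congr 1
    refine Finset.sum_congr rfl fun k _ => ?_
    rw [Finset.prod_boole, ite_mul, one_mul, zero_mul]
    refine @if_congr _ _ _ (_) (_) _ _ _ _ ⟨fun h e he => ?_, fun h u v huv => ?_⟩ rfl rfl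
    · induction e with
      | _ u v =>
        have hG : G.Adj u v := by
          simpa using Finset.mem_powerset.mp hS he
        simpa using h u v (by simpa using ⟨he, hG.ne⟩)
    · simpa using h s(u, v) (by simpa using ((fromEdgeSet_adj _).mp huv).1)
  rw [powerSumExpansion, map_sum, Finset.sum_congr rfl hpow, Finset.sum_comm, chromSymmPoly,
    Finset.sum_filter]
  refine Finset.sum_congr rfl fun k _ => ?_
  have hsub := Finset.prod_sub (R := MvPolynomial (Fin N) ℤ) (fun _ => 1)
    (fun e : Sym2 V => if (e.map k).IsDiag then 1 else 0) G.edgeFinset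
  simp only [Finset.prod_const_one, mul_one] at hsub
  rw [← Finset.sum_mul, ← hsub]
  have hite (e : Sym2 V) : (1 - if (e.map k).IsDiag then 1 else 0 : MvPolynomial (Fin N) ℤ) =
      if ¬ (e.map k).IsDiag then 1 else 0 := by
    split_ifs <;> simp_all
  simp only [hite]
  rw [Finset.prod_boole, ite_mul, one_mul, zero_mul]
  refine @if_congr _ _ _ (_) (_) _ _ _ _ ⟨fun h u v huv => ?_, fun h e he => ?_⟩ rfl rfl
  · simpa using h s(u, v) (by simpa using huv)
  · induction e with
    | _ u v => simpa using h u v (by simpa using he)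

lemma IsTree.irreducible_powerSumExpansion {V : Type*} [Fintype V] {G : SimpleGraph V}
    (hG : G.IsTree) : Irreducible G.powerSumExpansion := by
  classical
  have := hG.connected.nonempty
  set n := Nat.card V
  let term (S : Finset (Sym2 V)) : MvPolynomial ℕ ℤ := (-1) ^ S.card *
    ∏ c : (fromEdgeSet (S : Set (Sym2 V))).ConnectedComponent, X (Nat.card c.supp - 1)
  have hfull : term G.edgeFinset = (-1) ^ G.edgeFinset.card * X (n - 1) := by
    have hconn : (fromEdgeSet (G.edgeFinset : Set (Sym2 V))).Connected := by
      simpa using hG.connected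
    have := hconn.preconnected.subsingleton_connectedComponent
    obtain ⟨v⟩ := hconn.nonempty
    let c := (fromEdgeSet (G.edgeFinset : Set (Sym2 V))).connectedComponentMk v
    have hc : c.supp = Set.univ :=
      Set.eq_univ_of_forall fun u => ConnectedComponent.sound (hconn.preconnected u v)
    simp only [term]
    rw [Fintype.prod_subsingleton _ c, hc, Nat.card_univ]
  have hrest : ∑ S ∈ G.edgeFinset.powerset.erase G.edgeFinset, term S ∈
      supported ℤ ({n - 1}ᶜ : Set ℕ) := by
    refine sum_mem fun S hS => mul_mem (pow_mem (neg_mem (one_mem _)) _) (prod_mem fun c _ => ?_)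
    rw [X_mem_supported]
    rintro (hc : Nat.card c.supp - 1 = n - 1)
    rw [Finset.mem_erase, Finset.mem_powerset] at hS
    have : Nonempty c.supp := c.nonempty_supp.to_subtype
    have hpos : 0 < Nat.card c.supp := Nat.card_pos
    have hpos' : 0 < n := Nat.card_pos
    have huniv : c.supp = Set.univ :=
      Set.eq_of_subset_of_ncard_le (Set.subset_univ _)
        (by rw [Set.ncard_univ, ← Nat.card_coe_set_eq]; lia)
    have hconn : (fromEdgeSet (S : Set (Sym2 V))).Connected := by
      refine ⟨fun u v => ConnectedComponent.exact ?_⟩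
      rw [(c.mem_supp_iff u).mp (huniv ▸ Set.mem_univ u),
        (c.mem_supp_iff v).mp (huniv ▸ Set.mem_univ v)]
    have hle : fromEdgeSet (S : Set (Sym2 V)) ≤ G := by
      rw [fromEdgeSet_le]
      intro e he
      simpa using hS.2 he.1
    have hGS := (isTree_iff_minimal_connected.mp hG).le_of_le hconn hle
    refine hS.1 (hS.2.antisymm fun e he => ?_)
    have := edgeSet_mono hGS (mem_edgeFinset.mp he)
    rw [edgeSet_fromEdgeSet] at this
    exact this.1
  have hsum : G.powerSumExpansion = (-1) ^ G.edgeFinset.card * X (n - 1) +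
      ∑ S ∈ G.edgeFinset.powerset.erase G.edgeFinset, term S := by
    rw [← hfull, Finset.add_sum_erase _ _ (Finset.mem_powerset_self _)]
    rfl
  have hunit : IsUnit ((-1 : MvPolynomial ℕ ℤ) ^ G.edgeFinset.card) := isUnit_one.neg.pow _
  rw [hsum]
  refine irreducible_mul_X_add _ _ _ hunit.ne_zero ?_ ?_ hunit.isRelPrime_left
  · intro hmem
    have : (-1 : MvPolynomial ℕ ℤ) ^ G.edgeFinset.card ∈ supported ℤ (∅ : Set ℕ) :=
      pow_mem (neg_mem (one_mem _)) _
    exact mem_supported.mp this hmem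
  · exact fun hmem => mem_supported.mp hrest hmem rfl

lemma IsAcyclic.irreducible_powerSumExpansion_induce_supp {V : Type*} [Fintype V]
    {G : SimpleGraph V} (hG : G.IsAcyclic) (c : G.ConnectedComponent) [Fintype c.supp] :
    Irreducible (G.induce c.supp).powerSumExpansion :=
  IsTree.irreducible_powerSumExpansion ⟨c.connected_toSimpleGraph, hG.induce _⟩

lemma eval_one_chromSymmPoly_pos {V : Type*} [Fintype V] (G : SimpleGraph V) {N : ℕ}
    (hN : Fintype.card V ≤ N) : 0 < eval 1 (G.chromSymmPoly N) := by
  classical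
  simp only [chromSymmPoly, map_sum, map_prod, eval_X, Pi.one_apply, Finset.prod_const_one,
    Finset.sum_const, nsmul_eq_mul, mul_one]
  obtain ⟨f⟩ : Nonempty (V ↪ Fin N) := Function.Embedding.nonempty_of_card_le (by simpa using hN)
  rw [Nat.cast_pos, Finset.card_pos]
  exact ⟨f, by simpa using fun u v huv => huv.ne⟩

lemma powerSumExpansion_eq_of_associated {V W : Type*} [Fintype V] [Fintype W] {G : SimpleGraph V}
    {H : SimpleGraph W} (h : Associated G.powerSumExpansion H.powerSumExpansion) :
    G.powerSumExpansion = H.powerSumExpansion := by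
  obtain ⟨u, hu⟩ := h
  obtain ⟨a, ha, hau⟩ := (isUnit_iff_eq_C_of_isReduced).mp u.isUnit
  rcases Int.isUnit_iff.mp ha with rfl | rfl
  · rw [← hu, hau, C_1, mul_one]
  · exfalso
    let N := max (Fintype.card V) (Fintype.card W)
    have hG := G.eval_one_chromSymmPoly_pos (le_max_left _ _ : _ ≤ N)
    have hH := H.eval_one_chromSymmPoly_pos (le_max_right _ _ : _ ≤ N)
    rw [← powerSumEval_powerSumExpansion] at hG hH
    rw [← hu, hau] at hH
    simp at hH
    lia

end SimpleGraph

/-- if two forests have equal chromatic symmetric functions, then they have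
the same number of components and, after a suitable matching of the components, the
components have pairwise equal chromatic symmetric functions. -/
theorem stmt10 {V W : Type*} [Finite V] [Finite W]
    (T : SimpleGraph V) (F : SimpleGraph W)
    (hT : T.IsAcyclic) (hF : F.IsAcyclic) (h : csf T = csf F) :
    ∃ σ : T.ConnectedComponent ≃ F.ConnectedComponent,
      ∀ c, csf (T.induce c.supp) = csf (F.induce (σ c).supp) := by
  classical
  have := Fintype.ofFinite V
  have := Fintype.ofFinite W
  have hprod : ∏ c : T.ConnectedComponent, (T.induce c.supp).powerSumExpansion =
      ∏ c : F.ConnectedComponent, (F.induce c.supp).powerSumExpansion := by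
    refine MvPolynomial.powerSumEval_ext fun N => ?_
    simp only [map_prod, powerSumEval_powerSumExpansion]
    rw [← chromSymmPoly_eq_prod_connectedComponent, ← chromSymmPoly_eq_prod_connectedComponent]
    exact csf_eq_csf_iff.mp h N
  have hrel := UniqueFactorizationMonoid.factors_unique
    (f := Finset.univ.val.map fun c : T.ConnectedComponent => (T.induce c.supp).powerSumExpansion)
    (g := Finset.univ.val.map fun c : F.ConnectedComponent => (F.induce c.supp).powerSumExpansion)
    (by simpa using fun c => hT.irreducible_powerSumExpansion_induce_supp c)
    (by simpa using fun c => hF.irreducible_powerSumExpansion_induce_supp c) (Associated.of_eq hprod)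
  rw [Multiset.rel_map] at hrel
  obtain ⟨σ, hσ⟩ := exists_equiv_of_map_univ_eq _ _ <| Multiset.rel_eq.mp <|
    Multiset.rel_map.mpr <| hrel.mono fun c _ d _ => powerSumExpansion_eq_of_associated
  refine ⟨σ, fun c => csf_eq_csf_iff.mpr fun N => ?_⟩
  rw [← powerSumEval_powerSumExpansion, ← powerSumEval_powerSumExpansion, hσ c]
end

section
/- For any forest F and any positive integer j, the partial derivative of X_F with respect to the power sum p_j (regarding X_F as a polynomial in p_1, p_2, …) satisfies ∂X_F/∂p_j = (−1)^{j−1} Σ_H X_{F − V(H)}, where H ranges over all j-vertex subtrees of F. -/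
open SimpleGraph

/-- The power-sum symmetric function `p_k = Σ_i x_i ^ k`. -/
noncomputable def psum (k : Nat) : MvPowerSeries Nat Int :=
  open scoped Classical in
  fun d => if ∃ i : Nat, d = Finsupp.single i k then 1 else 0

/-- `p_lam` for a multiset of parts `lam`. -/
noncomputable def pProd (m : Multiset Nat) : MvPowerSeries Nat Int :=
  (m.map psum).prod

theorem coeff_psum (k : ℕ) (d : ℕ →₀ ℕ) [Decidable (∃ i : ℕ, d = Finsupp.single i k)] :
    MvPowerSeries.coeff d (psum k) = if ∃ i : ℕ, d = Finsupp.single i k then 1 else 0 := by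
  show psum k d = _
  unfold psum
  congr

theorem pderiv_psum (i k : ℕ) :
    MvPowerSeries.pderiv ℤ i (psum (k + 1)) =
      (k + 1 : MvPowerSeries ℕ ℤ) * MvPowerSeries.X i ^ k := by
  classical
  ext d
  have hk : (k + 1 : MvPowerSeries ℕ ℤ) = MvPowerSeries.C (k + 1 : ℤ) := by simp
  rw [MvPowerSeries.coeff_pderiv, coeff_psum, hk, MvPowerSeries.coeff_C_mul,
    MvPowerSeries.coeff_X_pow]
  have key : (∃ l, d + Finsupp.single i 1 = Finsupp.single l (k + 1)) ↔ d = Finsupp.single i k := by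
    constructor
    · rintro ⟨l, hl⟩
      have hli : l = i := by
        by_contra hne
        have := DFunLike.congr_fun hl i
        simp [hne] at this
      subst hli
      rw [Finsupp.single_add] at hl
      exact add_right_cancel hl
    · rintro rfl
      exact ⟨i, by rw [Finsupp.single_add]⟩
  by_cases h : d = Finsupp.single i k
  · subst h
    rw [if_pos (key.2 rfl), if_pos rfl]
    simp
  · rw [if_neg (key.not.2 h), if_neg h]
    simp

theorem Derivation.eventually_apply_aeval {σ R A : Type*} [CommRing R] [CommRing A] [Algebra R A]
    (D : Derivation R A A) (f : σ → A) (P : MvPolynomial σ R) :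
    ∀ᶠ s : Finset σ in Filter.atTop, D (MvPolynomial.aeval f P) =
      ∑ k ∈ s, MvPolynomial.aeval f (MvPolynomial.pderiv k P) * D (f k) := by
  classical
  induction P using MvPolynomial.induction_on with
  | C a => simp
  | add p q hp hq =>
    filter_upwards [hp, hq] with s hp hq
    simp only [map_add, hp, hq, add_mul, Finset.sum_add_distrib]
  | mul_X p n hp =>
    filter_upwards [hp, Filter.eventually_ge_atTop {n}] with s hp hn
    have hn : n ∈ s := by simpa using hn
    simp only [map_mul, MvPolynomial.aeval_X, Derivation.leibniz, hp, MvPolynomial.pderiv_X,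
      smul_eq_mul, map_add, add_mul, Finset.sum_add_distrib, Finset.mul_sum]
    congr 1
    · rw [Finset.sum_eq_single n (fun b _ hb => by simp [hb.symm]) (absurd hn)]
      simp
    · exact Finset.sum_congr rfl fun _ _ => by ring

theorem Derivation.apply_aeval_eq_sum {σ R A : Type*} [CommRing R] [CommRing A] [Algebra R A]
    (D : Derivation R A A) (f : σ → A) {P : MvPolynomial σ R} {s : Finset σ} (hs : P.vars ⊆ s) :
    D (MvPolynomial.aeval f P) =
      ∑ k ∈ s, MvPolynomial.aeval f (MvPolynomial.pderiv k P) * D (f k) := by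
  obtain ⟨t, ht, hst⟩ :=
    ((D.eventually_apply_aeval f P).and (Filter.eventually_ge_atTop s)).exists
  rw [ht]
  refine (Finset.sum_subset hst fun k _ hk => ?_).symm
  rw [MvPolynomial.pderiv_eq_zero_of_notMem_vars fun h => hk (hs h), map_zero, zero_mul]

theorem Finset.eq_zero_of_sum_mul_pow_eq_zero {A : Type*} [CommRing A] [IsDomain A]
    {x : ℕ → A} (hx : Function.Injective x) (s : Finset ℕ) (c : ℕ → A)
    (h : ∀ i, ∑ k ∈ s, c k * x i ^ k = 0) : ∀ k ∈ s, c k = 0 := by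
  have hp : ∑ k ∈ s, Polynomial.monomial k (c k) = 0 := by
    refine Polynomial.eq_zero_of_infinite_isRoot _
      ((Set.infinite_range_of_injective hx).mono ?_)
    rintro _ ⟨i, rfl⟩
    simpa [Polynomial.eval_finsetSum] using h i
  intro k hk
  have := congrArg (Polynomial.coeff · k) hp
  simpa [Polynomial.finsetSum_coeff, Polynomial.coeff_monomial, hk] using this

theorem MvPolynomial.totalDegree_pderiv_le {σ R : Type*} [CommRing R] {n : ℕ}
    {P : MvPolynomial σ R} (hP : P.totalDegree ≤ n + 1) (k : σ) :
    (pderiv k P).totalDegree ≤ n := by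
  refine Finset.sup_le fun m hm => ?_
  rw [mem_support_iff, coeff_pderiv] at hm
  have := (le_totalDegree (mem_support_iff.2 (left_ne_zero_of_mul hm))).trans hP
  rw [Finsupp.sum_add_index' (by simp) (by simp)] at this
  simpa using this

theorem MvPolynomial.eq_C_of_pderiv_eq_zero {σ R : Type*} [CommRing R] [IsDomain R] [CharZero R]
    {P : MvPolynomial σ R} (hP : ∀ k, pderiv k P = 0) : P = C (coeff 0 P) := by
  classical
  ext m
  rw [coeff_C]
  split_ifs with h
  · rw [h]
  · obtain ⟨k, hk⟩ := Finsupp.ne_iff.1 (Ne.symm h)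
    have h1 : Finsupp.single k 1 ≤ m := by
      simpa [Nat.one_le_iff_ne_zero] using hk
    have := congrArg (coeff (m - Finsupp.single k 1)) (hP k)
    rw [coeff_pderiv, tsub_add_cancel_of_le h1, coeff_zero] at this
    exact (mul_eq_zero.1 this).resolve_right (Nat.cast_add_one_ne_zero _)

theorem aeval_psum_injective :
    Function.Injective (MvPolynomial.aeval (R := ℤ) fun k : ℕ => psum (k + 1)) := by
  rw [injective_iff_map_eq_zero]
  suffices H : ∀ n (P : MvPolynomial ℕ ℤ), P.totalDegree ≤ n →
      MvPolynomial.aeval (fun k : ℕ => psum (k + 1)) P = 0 → P = 0 from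
    fun P hP => H _ P le_rfl hP
  have hC : ∀ a : ℤ, MvPolynomial.aeval (fun k : ℕ => psum (k + 1)) (MvPolynomial.C a) = 0 →
      a = 0 := by
    intro a ha
    have := congrArg MvPowerSeries.constantCoeff ha
    simpa using this
  intro n
  induction n with
  | zero =>
    intro P hP h0
    rw [Nat.le_zero, MvPolynomial.totalDegree_eq_zero_iff_eq_C] at hP
    rw [hP] at h0 ⊢
    rw [hC _ h0, map_zero]
  | succ n ih =>
    intro P hP h0
    have hd : ∀ k, MvPolynomial.pderiv k P = 0 := by
      intro k
      refine ih _ (MvPolynomial.totalDegree_pderiv_le hP k) ?_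
      have := NoZeroDivisors.to_isDomain (MvPowerSeries ℕ ℤ)
      let c := fun l => MvPolynomial.aeval (fun k : ℕ => psum (k + 1)) (MvPolynomial.pderiv l P)
      have hc : c k * (k + 1 : MvPowerSeries ℕ ℤ) = 0 := by
        refine Finset.eq_zero_of_sum_mul_pow_eq_zero (fun _ _ => MvPowerSeries.X_inj.1)
          (insert k P.vars) (fun l => c l * (l + 1 : MvPowerSeries ℕ ℤ)) (fun i => ?_) k
          (Finset.mem_insert_self _ _)
        have := (MvPowerSeries.pderiv ℤ i).apply_aeval_eq_sum (fun k : ℕ => psum (k + 1))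
          (P := P) (Finset.subset_insert k _)
        rw [h0, map_zero] at this
        simp only [pderiv_psum] at this
        simpa only [mul_assoc] using this.symm
      refine (mul_eq_zero.1 hc).resolve_right fun h => ?_
      have := congrArg MvPowerSeries.constantCoeff h
      simp only [map_add, map_natCast, map_one, map_zero] at this
      exact Nat.cast_add_one_ne_zero k this
    have := MvPolynomial.eq_C_of_pderiv_eq_zero hd
    rw [this] at h0 ⊢
    rw [hC _ h0, map_zero]

namespace SimpleGraph

variable {V : Type*} {G : SimpleGraph V}

theorem IsAcyclic.exists_leaf_ne [Finite V] (hG : G.IsAcyclic) (hne : G ≠ ⊥) (v : V) :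
    ∃ l u, l ≠ v ∧ ∀ x, G.Adj l x ↔ x = u := by
  obtain ⟨a, b, hab⟩ := ne_bot_iff_exists_adj.1 hne
  have : Nonempty V := ⟨a⟩
  obtain ⟨x, y, p, hp, hmax⟩ := Walk.exists_isPath_forall_isPath_length_le_length G
  have hnil : ¬p.Nil := by
    intro h
    have := hmax _ _ hab.toWalk (by simp [hab.ne])
    rw [Walk.length_eq_zero_iff.2 h] at this
    simp at this
  have hleaf : ∀ {x y : V} (p : G.Walk x y), p.IsPath → ¬p.Nil →
      (∀ a b (q : G.Walk a b), q.IsPath → q.length ≤ p.length) →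
      ∀ z, G.Adj x z ↔ z = p.snd := by
    intro x y p hp hnil hmax z
    refine ⟨fun hadj => hG.eq_snd_of_adj_start hp hadj ?_, fun h => h ▸ p.adj_snd hnil⟩
    by_contra hz
    have := hmax _ _ (p.cons hadj.symm) (hp.cons hz)
    simp at this
  by_cases hx : x = v
  · refine ⟨y, _, fun hy => ?_, hleaf p.reverse hp.reverse (by simpa using hnil)
      (by simpa using hmax)⟩
    exact hp.nil_iff_eq.not.mp hnil (hx.trans hy.symm)
  · exact ⟨x, _, hx, hleaf p hp hnil hmax⟩

theorem exists_adj_of_connected_induce {W : Set V} (h : (G.induce W).Connected) {x y : V}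
    (hx : x ∈ W) (hy : y ∈ W) (hxy : x ≠ y) : ∃ z ∈ W, G.Adj x z := by
  obtain ⟨p⟩ := h.preconnected ⟨x, hx⟩ ⟨y, hy⟩
  have := p.adj_snd (Walk.not_nil_of_ne fun h => hxy (congrArg Subtype.val h))
  exact ⟨p.snd, p.snd.2, this⟩

theorem connected_induce_diff_singleton {W : Set V} (h : (G.induce W).Connected) {l u v : V}
    (hl : ∀ x, G.Adj l x → x = u) (hv : v ∈ W) (hvl : v ≠ l) :
    (G.induce (W \ {l})).Connected := by
  have hpre : ((G.induce W).induce {x : W | x.1 ≠ l}).Preconnected := by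
    refine h.preconnected.induce_of_degree_eq_one fun x hx y hy z hz => ?_
    have hx : x.1 = l := by simpa using hx
    rw [mem_neighborSet, comap_adj] at hy hz
    simp only [Function.Embedding.subtype_apply, hx] at hy hz
    exact Subtype.ext ((hl _ hy).trans (hl _ hz).symm)
  let f : ((G.induce W).induce {x : W | x.1 ≠ l}) →g G.induce (W \ {l}) :=
    ⟨fun x => ⟨x.1.1, x.1.2, x.2⟩, fun h => h⟩
  have : Nonempty ↥(W \ {l}) := ⟨⟨v, hv, hvl⟩⟩
  exact ⟨hpre.map f fun x => ⟨⟨⟨x.1, x.2.1⟩, x.2.2⟩, rfl⟩⟩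

theorem connected_induce_insert {W : Set V} (h : (G.induce W).Connected) {l u : V}
    (hu : u ∈ W) (hlu : G.Adj l u) : (G.induce (insert l W)).Connected := by
  rw [Set.insert_eq]
  exact connected_induce_union (Preconnected.of_subsingleton) h.preconnected
    (Set.mem_singleton l) hu hlu

open scoped Classical in
/-- The signed count of the connected vertex covers of a forest through a fixed vertex. -/
theorem IsAcyclic.sum_connected_cover [Finite V] (hG : G.IsAcyclic) (A : Finset V)
    (hA : ∀ x y, G.Adj x y → x ∈ A) {v : V} (hv : v ∈ A) :
    ∑ W ∈ A.powerset.filter (fun W : Finset V => v ∈ W ∧ (G.induce (W : Set V)).Connected ∧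
      ∀ x y, G.Adj x y → x ∈ W ∨ y ∈ W), (-1 : ℤ) ^ (W.card + 1) = if G = ⊥ then 1 else 0 := by
  split_ifs with hbot
  · subst hbot
    rw [Finset.sum_eq_single_of_mem {v}]
    · simp
    · simp [hv, Connected.of_subsingleton]
    · intro W hW hne
      simp only [Finset.mem_filter] at hW
      obtain ⟨w, hw, hwv⟩ : ∃ w ∈ W, w ≠ v := by
        by_contra! h
        exact hne (Finset.eq_singleton_iff_unique_mem.2 ⟨hW.2.1, h⟩)
      obtain ⟨z, -, hz⟩ := exists_adj_of_connected_induce hW.2.2.1 hw hW.2.1 hwv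
      exact hz.elim
  · obtain ⟨l, u, hlv, hl⟩ := hG.exists_leaf_ne hbot v
    have hlu : G.Adj l u := (hl u).2 rfl
    have hlA : l ∈ A := hA _ _ hlu
    refine Finset.sum_involution
      (fun W _ => if l ∈ W then W.erase l else insert l W) ?_ ?_ ?_ ?_
    · intro W _
      split_ifs with hlW
      · rw [← Finset.card_erase_add_one hlW]
        ring
      · rw [Finset.card_insert_of_notMem hlW]
        ring
    · intro W _ _
      split_ifs with hlW
      · exact fun h => Finset.erase_eq_self.1 h hlW
      · exact fun h => hlW (Finset.insert_eq_self.1 h)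
    · intro W hW
      simp only [Finset.mem_filter, Finset.mem_powerset] at hW ⊢
      obtain ⟨hWA, hvW, hconn, hcov⟩ := hW
      by_cases hlW : l ∈ W
      · rw [if_pos hlW]
        have huW : u ∈ W := by
          obtain ⟨z, hzW, hz⟩ := exists_adj_of_connected_induce hconn hlW hvW hlv
          exact (hl z).1 hz ▸ hzW
        refine ⟨(Finset.erase_subset _ _).trans hWA, Finset.mem_erase.2 ⟨hlv.symm, hvW⟩, ?_, ?_⟩
        · rw [Finset.coe_erase]
          exact connected_induce_diff_singleton hconn (fun x => (hl x).1) hvW hlv.symm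
        · intro x y hxy
          simp only [Finset.mem_erase]
          have := hcov x y hxy
          have h1 : x = l → y = u := fun h => (hl y).1 (h ▸ hxy)
          have h2 : y = l → x = u := fun h => (hl x).1 (h ▸ hxy.symm)
          have h3 := hlu.ne
          grind
      · rw [if_neg hlW]
        have huW : u ∈ W := (hcov _ _ hlu).resolve_left hlW
        refine ⟨Finset.insert_subset hlA hWA, Finset.mem_insert_of_mem hvW, ?_, ?_⟩
        · rw [Finset.coe_insert]
          exact connected_induce_insert hconn huW hlu
        · exact fun x y hxy => (hcov x y hxy).imp Finset.mem_insert_of_mem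
            Finset.mem_insert_of_mem
    · intro W _
      split_ifs with hlW h h
      · exact absurd h (Finset.notMem_erase l W)
      · exact Finset.insert_erase hlW
      · exact Finset.erase_insert hlW
      · exact absurd (Finset.mem_insert_self l W) h

theorem connected_induce_sup_iff {ι : Type*} {W : Set V} (k : V → ι) {M : SimpleGraph V}
    (hM : ∀ x ∈ W, ∀ y ∈ W, M.Adj x y ↔ G.Adj x y ∧ k x = k y) :
    (M.induce W).Connected ↔
      (G.induce W).Connected ∧ ∀ x ∈ W, ∀ y ∈ W, k x = k y := by
  constructor
  · intro h
    refine ⟨h.mono fun x y hxy => ((hM x x.2 y y.2).1 hxy).1, fun x hx y hy => ?_⟩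
    obtain ⟨p⟩ := h.preconnected ⟨x, hx⟩ ⟨y, hy⟩
    have : ∀ {a b : W}, (M.induce W).Walk a b → k a = k b := by
      intro a b p
      induction p with
      | nil => rfl
      | cons hadj _ ih => exact ((hM _ (Subtype.prop _) _ (Subtype.prop _)).1 hadj).2.trans ih
    exact this p
  · rintro ⟨h, hk⟩
    exact h.mono fun x y hxy => (hM x x.2 y y.2).2 ⟨hxy, hk x x.2 y y.2⟩

end SimpleGraph

section Coloring

open Finset

variable {V : Type*}

/-- The multiset of colors that `k` uses on `A`, as an exponent vector. -/
noncomputable def colorContent (A : Finset V) (k : V → ℕ) : ℕ →₀ ℕ :=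
  ∑ v ∈ A, Finsupp.single (k v) 1

theorem finite_setOf_colorContent_eq [Finite V] (A : Finset V) (d : ℕ →₀ ℕ) :
    {k : V → ℕ | (∀ v ∉ A, k v = 0) ∧ colorContent A k = d}.Finite := by
  classical
  refine (Set.Finite.pi' fun _ : V => (insert 0 d.support).finite_toSet).subset ?_
  rintro k ⟨hk, rfl⟩ v
  by_cases hv : v ∈ A
  · simp only [coe_insert, Set.mem_insert_iff, mem_coe, Finsupp.mem_support_iff]
    refine Or.inr fun h => ?_
    simp only [colorContent, Finsupp.finsetSum_apply, Finset.sum_eq_zero_iff] at h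
    simpa using h v hv
  · simp [hk v hv]

/-- The maps `V → ℕ` that vanish outside `A` and have color content `d` on `A`. -/
noncomputable def colorMaps [Finite V] (A : Finset V) (d : ℕ →₀ ℕ) : Finset (V → ℕ) :=
  (finite_setOf_colorContent_eq A d).toFinset

theorem mem_colorMaps [Finite V] {A : Finset V} {d : ℕ →₀ ℕ} {k : V → ℕ} :
    k ∈ colorMaps A d ↔ (∀ v ∉ A, k v = 0) ∧ colorContent A k = d := by
  simp [colorMaps]

/-- `k` is constant on `W` and is a proper coloring of the subgraph induced on `A \ W`. -/
def ProperOff (F : SimpleGraph V) (A W : Finset V) (k : V → ℕ) : Prop :=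
  (∀ x ∈ W, ∀ y ∈ W, k x = k y) ∧
    ∀ x ∈ A, ∀ y ∈ A, x ∉ W → y ∉ W → F.Adj x y → k x ≠ k y

theorem csf_apply_iff {U : Type*} [Fintype U] {k : U → ℕ} {d : ℕ →₀ ℕ} :
    (∀ i : ℕ, (∑ᶠ v ∈ {v : U | k v = i}, 1) = d i) ↔ colorContent univ k = d := by
  classical
  rw [Finsupp.ext_iff]
  refine forall_congr' fun i => ?_
  rw [finsum_mem_def, finsum_eq_sum_of_fintype]
  simp [colorContent, Finsupp.finsetSum_apply, Finsupp.single_apply, Set.indicator_apply]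

open scoped Classical in
theorem coeff_csf_of_embedding [Finite V] {U : Type*} [Fintype U] {G : SimpleGraph U}
    {F : SimpleGraph V} (f : G ↪g F) {A : Finset V} (hf : univ.map f.toEmbedding = A)
    (d : ℕ →₀ ℕ) :
    MvPowerSeries.coeff d (csf G) = #{k ∈ colorMaps A d | ProperOff F A ∅ k} := by
  have hA : ∀ v, v ∈ A ↔ ∃ u, f u = v := by simp [← hf]
  show ((Nat.card _ : ℕ) : ℤ) = _
  rw [Nat.cast_inj, Nat.card_coe_set_eq, ← Set.ncard_coe_finset]
  have hinj : Set.InjOn (fun k : V → ℕ => k ∘ f)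
      ↑({k ∈ colorMaps A d | ProperOff F A ∅ k} : Finset (V → ℕ)) := by
    intro k hk l hl h
    simp only [coe_filter, Set.mem_ofPred_eq, mem_colorMaps] at hk hl
    funext v
    by_cases hv : v ∈ A
    · obtain ⟨u, rfl⟩ := (hA v).1 hv
      exact congrFun h u
    · rw [hk.1.1 v hv, hl.1.1 v hv]
  rw [← hinj.ncard_image]
  congr 1
  have hcontent : ∀ k : V → ℕ, colorContent A k = colorContent univ (k ∘ f) := by
    intro k
    rw [colorContent, ← hf, Finset.sum_map]
    rfl
  ext k
  simp only [Set.mem_ofPred_eq, coe_filter, Set.mem_image, mem_colorMaps, hcontent]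
  constructor
  · rintro ⟨hp, hc⟩
    have hk : Function.extend f k 0 ∘ f = k := funext fun u => f.injective.extend_apply k 0 u
    refine ⟨Function.extend f k 0, ⟨⟨fun v hv => ?_, by rw [hk, csf_apply_iff.1 hc]⟩,
      by simp, ?_⟩, hk⟩
    · rw [Function.extend_apply' _ _ _ (mt (hA v).2 hv)]
      rfl
    · intro x hx y hy _ _ hxy
      obtain ⟨a, rfl⟩ := (hA x).1 hx
      obtain ⟨b, rfl⟩ := (hA y).1 hy
      rw [f.injective.extend_apply, f.injective.extend_apply]
      exact hp a b ((mem_edgeSet G).2 (f.map_adj_iff.1 hxy))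
  · rintro ⟨l, ⟨⟨-, hc⟩, -, hp⟩, rfl⟩
    exact ⟨fun a b hab => hp _ ((hA _).2 ⟨a, rfl⟩) _ ((hA _).2 ⟨b, rfl⟩) (by simp) (by simp)
      (f.map_adj_iff.2 ((mem_edgeSet G).1 hab)), csf_apply_iff.2 hc⟩

open scoped Classical in
theorem coeff_csf_induce [Finite V] (F : SimpleGraph V) (A : Finset V) (d : ℕ →₀ ℕ) :
    MvPowerSeries.coeff d (csf (F.induce (A : Set V))) =
      #{k ∈ colorMaps A d | ProperOff F A ∅ k} :=
  coeff_csf_of_embedding (Embedding.induce (A : Set V)) (by ext; simp) d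

theorem colorContent_eq_single_add [DecidableEq V] {A W : Finset V} (hW : W ⊆ A) {k : V → ℕ}
    {c : ℕ} (hk : ∀ x ∈ W, k x = c) :
    colorContent A k = Finsupp.single c #W + colorContent (A \ W) k := by
  rw [colorContent, ← Finset.sum_sdiff hW, add_comm, colorContent]
  congr 1
  rw [Finset.sum_congr rfl fun x hx => by rw [hk x hx]]
  simp

open scoped Classical in
/-- Multiplying by `p_{|W|}` amounts to coloring the whole of `W` with one color. -/
theorem coeff_psum_mul_csf [Finite V] (F : SimpleGraph V) {A W : Finset V} (hW : W ⊆ A)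
    (hne : W.Nonempty) (d : ℕ →₀ ℕ) :
    MvPowerSeries.coeff d (psum #W * csf (F.induce ((A \ W : Finset V) : Set V))) =
      #{k ∈ colorMaps A d | ProperOff F A W k} := by
  obtain ⟨v, hv⟩ := hne
  have hpos : #W ≠ 0 := (Finset.card_pos.2 ⟨v, hv⟩).ne'
  rw [MvPowerSeries.coeff_mul, Finset.card_eq_sum_card_fiberwise (t := antidiagonal d)
    (f := fun k => (Finsupp.single (k v) #W, colorContent (A \ W) k)), Nat.cast_sum]
  swap
  · intro k hk
    simp only [coe_filter, Set.mem_ofPred_eq, mem_colorMaps] at hk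
    simp only [mem_coe, HasAntidiagonal.mem_antidiagonal]
    rw [← hk.1.2, colorContent_eq_single_add hW fun x hx => hk.2.1 x hx v hv]
  refine Finset.sum_congr rfl fun ⟨a, b⟩ hab => ?_
  rw [HasAntidiagonal.mem_antidiagonal] at hab
  dsimp only at hab ⊢
  rw [coeff_psum, coeff_csf_induce]
  split_ifs with h
  · obtain ⟨i, rfl⟩ := h
    rw [one_mul, Nat.cast_inj]
    have hdis : ∀ x ∈ A \ W, x ∉ W := fun x hx => (Finset.mem_sdiff.1 hx).2
    refine Finset.card_nbij' (fun k x => if x ∈ W then i else k x)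
      (fun k x => if x ∈ W then 0 else k x) ?_ ?_ ?_ ?_
    · intro k hk
      simp only [coe_filter, Set.mem_ofPred_eq, mem_colorMaps, mem_filter] at hk ⊢
      obtain ⟨⟨hk0, hkb⟩, -, hkp⟩ := hk
      have hc : colorContent (A \ W) (fun x => if x ∈ W then i else k x) = b := by
        rw [← hkb]
        exact Finset.sum_congr rfl fun x hx => by simp only [if_neg (hdis x hx)]
      refine ⟨⟨⟨fun x hx => ?_, ?_⟩, ?_, ?_⟩, ?_⟩
      · rw [if_neg fun h => hx (hW h)]
        exact hk0 x fun h => hx (Finset.mem_sdiff.1 h).1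
      · rw [colorContent_eq_single_add hW (c := i) fun x hx => if_pos hx, hc, hab]
      · intro x hx y hy
        simp only [if_pos hx, if_pos hy]
      · intro x hx y hy hxW hyW hxy
        simp only [if_neg hxW, if_neg hyW]
        exact hkp x (by simp [hx, hxW]) y (by simp [hy, hyW]) (by simp) (by simp) hxy
      · rw [if_pos hv, hc]
    · intro k hk
      simp only [coe_filter, Set.mem_ofPred_eq, mem_colorMaps, mem_filter, Prod.mk.injEq] at hk ⊢
      obtain ⟨⟨⟨hk0, -⟩, -, hkp⟩, -, hkb⟩ := hk
      refine ⟨⟨fun x hx => ?_, ?_⟩, by simp, ?_⟩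
      · split_ifs with h
        · rfl
        · exact hk0 x fun hxA => hx (Finset.mem_sdiff.2 ⟨hxA, h⟩)
      · rw [← hkb]
        exact Finset.sum_congr rfl fun x hx => by simp only [if_neg (hdis x hx)]
      · intro x hx y hy _ _ hxy
        simp only [if_neg (hdis x hx), if_neg (hdis y hy)]
        exact hkp x (Finset.mem_sdiff.1 hx).1 y (Finset.mem_sdiff.1 hy).1 (hdis x hx) (hdis y hy)
          hxy
    · intro k hk
      simp only [coe_filter, Set.mem_ofPred_eq, mem_colorMaps] at hk
      funext x
      by_cases hx : x ∈ W
      · simp only [if_pos hx]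
        exact (hk.1.1 x (by simp [hx])).symm
      · simp only [if_neg hx]
    · intro k hk
      simp only [coe_filter, Set.mem_ofPred_eq, mem_colorMaps, mem_filter, Prod.mk.injEq] at hk
      obtain ⟨⟨-, hkW, -⟩, hki, -⟩ := hk
      funext x
      by_cases hx : x ∈ W
      · simp only [if_pos hx]
        rw [hkW x hx v hv]
        exact (Finsupp.single_left_injective hpos hki).symm
      · simp only [if_neg hx]
  · rw [zero_mul, eq_comm, Nat.cast_eq_zero, Finset.card_eq_zero, Finset.filter_eq_empty_iff]
    exact fun k _ hk => h ⟨k v, (Prod.ext_iff.1 hk).1.symm⟩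

open scoped Classical in
theorem sum_properOff [Finite V] {F : SimpleGraph V} (hF : F.IsAcyclic) {A : Finset V} {v : V}
    (hv : v ∈ A) (k : V → ℕ) :
    ∑ W ∈ A.powerset.filter (fun W : Finset V => v ∈ W ∧ (F.induce (W : Set V)).Connected),
      (if ProperOff F A W k then (-1 : ℤ) ^ (#W + 1) else 0) =
      if ProperOff F A ∅ k then 1 else 0 := by
  obtain ⟨M, hM⟩ : ∃ M : SimpleGraph V,
      ∀ x y, M.Adj x y ↔ (F.Adj x y ∧ k x = k y) ∧ x ∈ A ∧ y ∈ A :=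
    ⟨{ Adj := fun x y => (F.Adj x y ∧ k x = k y) ∧ x ∈ A ∧ y ∈ A
       symm := ⟨fun x y h => ⟨⟨h.1.1.symm, h.1.2.symm⟩, h.2.2, h.2.1⟩⟩
       loopless := ⟨fun x h => h.1.1.ne rfl⟩ }, fun _ _ => Iff.rfl⟩
  have hMF : M.IsAcyclic := hF.anti fun x y h => ((hM x y).1 h).1.1
  have hcover : ∀ W : Finset V, (∀ x y, M.Adj x y → x ∈ W ∨ y ∈ W) ↔
      ∀ x ∈ A, ∀ y ∈ A, x ∉ W → y ∉ W → F.Adj x y → k x ≠ k y := by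
    refine fun W => ⟨fun h x hx y hy hxW hyW hxy hk => ?_, fun h x y hxy => ?_⟩
    · exact (h x y ((hM x y).2 ⟨⟨hxy, hk⟩, hx, hy⟩)).elim hxW hyW
    · by_contra! hW
      obtain ⟨⟨hF, hk⟩, hx, hy⟩ := (hM x y).1 hxy
      exact h x hx y hy hW.1 hW.2 hF hk
  have hbot : M = ⊥ ↔ ProperOff F A ∅ k := by
    rw [eq_bot_iff_forall_not_adj, ProperOff, ← hcover ∅]
    simp
  rw [← Finset.sum_filter, Finset.filter_filter]
  refine (Finset.sum_congr (Finset.filter_congr fun W hW => ?_) fun _ _ => rfl).trans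
    ((hMF.sum_connected_cover A (fun x y h => ((hM x y).1 h).2.1) hv).trans
      (if_congr hbot rfl rfl))
  rw [Finset.mem_powerset] at hW
  rw [connected_induce_sup_iff (G := F) (M := M) k fun x hx y hy =>
    (hM x y).trans (and_iff_left ⟨hW hx, hW hy⟩), hcover, ProperOff]
  simp only [mem_coe, and_assoc]

open scoped Classical in
/-- The expansion of `X_F` over the subtrees of a forest through a fixed vertex. -/
theorem csf_induce_eq_sum [Finite V] {F : SimpleGraph V} (hF : F.IsAcyclic) {A : Finset V} {v : V}
    (hv : v ∈ A) :
    csf (F.induce (A : Set V)) =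
      ∑ W ∈ A.powerset.filter (fun W : Finset V => v ∈ W ∧ (F.induce (W : Set V)).Connected),
        (-1) ^ (#W + 1) * (psum #W * csf (F.induce ((A \ W : Finset V) : Set V))) := by
  ext d
  have hterm : ∀ W ∈ A.powerset.filter
      (fun W : Finset V => v ∈ W ∧ (F.induce (W : Set V)).Connected),
      MvPowerSeries.coeff d
        ((-1) ^ (#W + 1) * (psum #W * csf (F.induce ((A \ W : Finset V) : Set V)))) =
      ∑ k ∈ colorMaps A d, if ProperOff F A W k then (-1 : ℤ) ^ (#W + 1) else 0 := by
    intro W hW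
    rw [Finset.mem_filter, Finset.mem_powerset] at hW
    have hs : ((-1) ^ (#W + 1) : MvPowerSeries ℕ ℤ) = MvPowerSeries.C ((-1) ^ (#W + 1)) := by simp
    rw [hs, MvPowerSeries.coeff_C_mul, coeff_psum_mul_csf F hW.1 ⟨v, hW.2.1⟩,
      ← Finset.sum_filter, Finset.sum_const, nsmul_eq_mul, mul_comm]
  rw [map_sum, Finset.sum_congr rfl hterm, Finset.sum_comm,
    Finset.sum_congr rfl fun k _ => sum_properOff hF hv k, coeff_csf_induce, ← Finset.sum_filter]
  simp

theorem csf_induce_empty [Finite V] (F : SimpleGraph V) :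
    csf (F.induce ((∅ : Finset V) : Set V)) = 1 := by
  classical
  ext d
  rw [coeff_csf_induce, MvPowerSeries.coeff_one]
  split_ifs with hd
  · rw [Nat.cast_eq_one, Finset.card_eq_one]
    refine ⟨0, ?_⟩
    ext k
    simp [mem_colorMaps, colorContent, ProperOff, hd, funext_iff]
  · rw [Nat.cast_eq_zero, Finset.card_eq_zero, Finset.filter_eq_empty_iff]
    intro k hk
    simp [mem_colorMaps, colorContent, Ne.symm hd] at hk

open scoped Classical in
/-- A polynomial in the power sums representing `X_F`, together with its partial derivatives. -/
theorem exists_aeval_psum_eq_csf [Finite V] {F : SimpleGraph V} (hF : F.IsAcyclic)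
    (A : Finset V) :
    ∃ Q : MvPolynomial ℕ ℤ,
      MvPolynomial.aeval (fun k : ℕ => psum (k + 1)) Q = csf (F.induce (A : Set V)) ∧
      ∀ j, MvPolynomial.aeval (fun k : ℕ => psum (k + 1)) (MvPolynomial.pderiv j Q) =
        (-1) ^ j * ∑ H ∈ A.powerset.filter
          (fun H : Finset V => #H = j + 1 ∧ (F.induce (H : Set V)).Connected),
          csf (F.induce ((A \ H : Finset V) : Set V)) := by
  induction A using Finset.strongInduction with
  | H A ih =>
  obtain rfl | ⟨v, hv⟩ := A.eq_empty_or_nonempty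
  · refine ⟨1, by rw [csf_induce_empty, map_one], fun j => ?_⟩
    rw [MvPolynomial.pderiv_one, map_zero, Finset.sum_eq_zero, mul_zero]
    intro H hH
    simp only [powerset_empty, mem_filter, mem_singleton] at hH
    simp [hH.1] at hH
  choose! Q hQ hderiv using ih
  let S : Finset V → Finset (Finset V) := fun B =>
    B.powerset.filter fun W : Finset V => v ∈ W ∧ (F.induce (W : Set V)).Connected
  have hexp : ∀ B : Finset V, v ∈ B → csf (F.induce (B : Set V)) = ∑ W ∈ S B,
      (-1) ^ (#W + 1) * (psum #W * csf (F.induce ((B \ W : Finset V) : Set V))) :=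
    fun B hB => csf_induce_eq_sum hF hB
  have hS : ∀ {W B}, W ∈ S B ↔ W ⊆ B ∧ v ∈ W ∧ (F.induce (W : Set V)).Connected := by
    intro W B
    rw [Finset.mem_filter, Finset.mem_powerset]
  clear_value S
  have hss : ∀ W ∈ S A, A \ W ⊂ A := fun W hW =>
    Finset.sdiff_ssubset (hS.1 hW).1 ⟨v, (hS.1 hW).2.1⟩
  have hcard : ∀ W ∈ S A, #W - 1 + 1 = #W := fun W hW =>
    Nat.sub_add_cancel (Finset.card_pos.2 ⟨v, (hS.1 hW).2.1⟩)
  refine ⟨∑ W ∈ S A, (-1) ^ (#W + 1) * (MvPolynomial.X (#W - 1) * Q (A \ W)), ?_, fun j => ?_⟩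
  · rw [hexp A hv, map_sum]
    refine Finset.sum_congr rfl fun W hW => ?_
    rw [map_mul, map_mul, MvPolynomial.aeval_X, hcard W hW, hQ _ (hss W hW)]
    simp
  have hterm : ∀ W ∈ S A, MvPolynomial.aeval (fun k : ℕ => psum (k + 1))
      (MvPolynomial.pderiv j ((-1) ^ (#W + 1) * (MvPolynomial.X (#W - 1) * Q (A \ W)))) =
      (if #W = j + 1 then (-1) ^ j * csf (F.induce ((A \ W : Finset V) : Set V)) else 0) +
      ∑ H ∈ (A \ W).powerset.filter
        (fun H : Finset V => #H = j + 1 ∧ (F.induce (H : Set V)).Connected),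
        (-1) ^ j * ((-1) ^ (#W + 1) *
          (psum #W * csf (F.induce (((A \ W) \ H : Finset V) : Set V)))) := by
    intro W hW
    have hs : ((-1) ^ (#W + 1) : MvPolynomial ℕ ℤ) = MvPolynomial.C ((-1) ^ (#W + 1)) := by simp
    rw [hs, MvPolynomial.pderiv_C_mul, MvPolynomial.pderiv_mul, map_mul, map_add, map_mul, map_mul,
      MvPolynomial.aeval_X, hcard W hW, hQ _ (hss W hW), hderiv _ (hss W hW), mul_add]
    congr 1
    · have hc := hcard W hW
      split_ifs with hj
      · obtain rfl : #W - 1 = j := by omega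
        rw [MvPolynomial.pderiv_X_self, ← hc]
        simp [pow_succ]
      · rw [MvPolynomial.pderiv_X_of_ne (by omega)]
        simp
    · simp only [Finset.mul_sum]
      refine Finset.sum_congr rfl fun H _ => ?_
      simp only [map_pow, map_neg, map_one]
      ring
  rw [map_sum, map_sum, Finset.sum_congr rfl hterm, Finset.sum_add_distrib, Finset.mul_sum,
    ← Finset.sum_filter_add_sum_filter_not (A.powerset.filter _) (fun H : Finset V => v ∈ H)]
  congr 1
  · rw [← Finset.sum_filter]
    refine Finset.sum_congr ?_ fun _ _ => rfl
    ext W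
    simp only [Finset.mem_filter, hS, Finset.mem_powerset]
    tauto
  · refine (Finset.sum_comm' (t' := (A.powerset.filter
      (fun H : Finset V => #H = j + 1 ∧ (F.induce (H : Set V)).Connected)).filter (v ∉ ·))
      (s' := fun H => S (A \ H)) ?_).trans ?_
    · intro W H
      simp only [Finset.mem_filter, hS, Finset.mem_powerset, Finset.subset_sdiff]
      constructor
      · rintro ⟨⟨hW, hvW, hWc⟩, ⟨hH, hdis⟩, hHc⟩
        exact ⟨⟨⟨hW, hdis.symm⟩, hvW, hWc⟩, ⟨hH, hHc⟩,
          fun hvH => Finset.disjoint_left.1 hdis hvH hvW⟩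
      · rintro ⟨⟨⟨hW, hdis⟩, hvW, hWc⟩, ⟨hH, hHc⟩, -⟩
        exact ⟨⟨hW, hvW, hWc⟩, ⟨hH, hdis.symm⟩, hHc⟩
    · refine Finset.sum_congr rfl fun H hH => ?_
      rw [hexp (A \ H) (Finset.mem_sdiff.2 ⟨hv, (Finset.mem_filter.1 hH).2⟩), Finset.mul_sum]
      refine Finset.sum_congr rfl fun W _ => ?_
      rw [sdiff_right_comm]

end Coloring

/-- for a forest `F`, writing `X_F` as a polynomial in the power sums
(`P` evaluated at `p₁, p₂, …`), one has
`∂X_F/∂p_j = (-1)^(j-1) Σ_H X_{F - V(H)}`, summed over all `j`-vertex subtrees `H` of `F`. -/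
theorem stmt11 {V : Type*} [Finite V] (F : SimpleGraph V) (hF : F.IsAcyclic)
    (j : Nat) (hj : 1 ≤ j) (P : MvPolynomial Nat Int)
    (hP : MvPolynomial.aeval (fun k : Nat => psum (k + 1)) P = csf F) :
    MvPolynomial.aeval (fun k : Nat => psum (k + 1)) (MvPolynomial.pderiv (j - 1) P) =
      (-1 : MvPowerSeries Nat Int) ^ (j - 1) *
        ∑ᶠ W ∈ {W : Set V | W.ncard = j ∧ (F.induce W).Connected},
          csf (F.induce Wᶜ) := by
  classical
  have := Fintype.ofFinite V
  obtain ⟨Q, hQ, hderiv⟩ := exists_aeval_psum_eq_csf hF Finset.univ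
  have huniv : csf (F.induce ((Finset.univ : Finset V) : Set V)) = csf F := by
    ext d
    rw [coeff_csf_induce, coeff_csf_of_embedding (A := Finset.univ)
      (Embedding.refl (G := F)) (by ext; simp)]
  obtain rfl : Q = P := aeval_psum_injective (by rw [hQ, huniv, hP])
  rw [hderiv, Nat.sub_add_cancel hj, ← finsum_mem_coe_finset]
  congr 1
  refine finsum_mem_eq_of_bijOn (fun W : Finset V => (W : Set V))
    ⟨fun W hW => ?_, Finset.coe_injective.injOn, fun W hW => ?_⟩ fun W _ => ?_
  · simpa [Set.ncard_coe_finset] using hW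
  · obtain ⟨W, rfl⟩ : ∃ W' : Finset V, (W' : Set V) = W := ⟨W.toFinset, Set.coe_toFinset W⟩
    exact ⟨W, by simpa [Set.ncard_coe_finset] using hW, rfl⟩
  · rw [← Finset.compl_eq_univ_sdiff, Finset.coe_compl]
end

section
/- Let T be a tree on n vertices, and for a subtree H of T let d(V(H)) denote the number of components of T − V(H). Let f_T(i,j) be the number of i-vertex subtrees H of T with d(V(H)) = j. Then f_T(i,j) = Σ_{λ⊢n} σ(λ,i,j) c_λ(T), where σ(λ,i,j) = (−1)^{n−j−1} · C(n−i−l(λ)+1, j−l(λ)+1) · m_i(λ), with m_i(λ) the number of parts of λ equal to i, l(λ) the number of parts of λ, and X_T = Σ_{λ⊢n} c_λ(T) p_λ the power-sum expansion of the chromatic symmetric function of T. -/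
open SimpleGraph

/-- `fT T i j` : the number of `i`-vertex subtrees `H` of `T` (connected induced subgraphs)
such that `T - V(H)` has exactly `j` connected components. -/
noncomputable def fT {V : Type*} [Finite V] (T : SimpleGraph V) (i j : Nat) : Nat :=
  Nat.card {W : Set V | W.ncard = i ∧ (T.induce W).Connected ∧
    Nat.card (T.induce Wᶜ).ConnectedComponent = j}

namespace SimpleGraph

variable {V : Type*} [Fintype V]

open scoped Classical in
/-- The edges of `G` with both endpoints in `W`. -/
noncomputable def edgesWithin (G : SimpleGraph V) (W : Set V) : Finset (Sym2 V) :=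
  G.edgeFinset ∩ W.toFinset.sym2

theorem mk_mem_edgesWithin {G : SimpleGraph V} {W : Set V} {u v : V} :
    s(u, v) ∈ G.edgesWithin W ↔ G.Adj u v ∧ u ∈ W ∧ v ∈ W := by
  simp [edgesWithin]

theorem card_edgesWithin (G : SimpleGraph V) (W : Set V) [Fintype (G.induce W).edgeSet] :
    (G.edgesWithin W).card = (G.induce W).edgeFinset.card := by
  classical
  rw [edgesWithin, ← Finset.card_map (Function.Embedding.subtype (· ∈ W)).sym2Map]
  convert congrArg Finset.card (map_edgeFinset_induce (G := G) (s := W)).symm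

/-- A forest has as many vertices as edges and connected components together. -/
theorem IsAcyclic.card_edgeFinset_add_card_connectedComponent {G : SimpleGraph V}
    [Fintype G.edgeSet] (hG : G.IsAcyclic) :
    G.edgeFinset.card + Nat.card G.ConnectedComponent = Fintype.card V := by
  classical
  have hE : G.edgeFinset =
      Finset.univ.biUnion fun c : G.ConnectedComponent => G.edgesWithin c.supp := by
    ext e
    induction e with | _ u v
    simp only [mem_edgeFinset, mem_edgeSet, Finset.mem_biUnion, Finset.mem_univ, true_and,
      mk_mem_edgesWithin, ConnectedComponent.mem_supp_iff]
    exact ⟨fun h => ⟨_, h, rfl, (ConnectedComponent.sound h.reachable).symm⟩, fun ⟨_, h, _⟩ => h⟩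
  have hdisj : Set.PairwiseDisjoint (Finset.univ : Finset G.ConnectedComponent)
      fun c : G.ConnectedComponent => G.edgesWithin c.supp := by
    intro c _ c' _ hne
    refine Finset.disjoint_left.2 fun e => ?_
    induction e with | _ u v
    simp only [mk_mem_edgesWithin, ConnectedComponent.mem_supp_iff]
    rintro ⟨_, h, _⟩ ⟨_, h', _⟩
    exact hne (h.symm.trans h')
  have hV : Fintype.card V = ∑ c : G.ConnectedComponent, Fintype.card c.supp := by
    rw [← Finset.card_univ, Finset.card_eq_sum_card_fiberwise
      (f := G.connectedComponentMk) (t := Finset.univ) (by simp)]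
    refine Finset.sum_congr rfl fun c _ => ?_
    rw [Fintype.card_subtype]
    simp only [ConnectedComponent.mem_supp_iff]
  rw [hE, Finset.card_biUnion hdisj, hV, Nat.card_eq_fintype_card, Fintype.card_eq_sum_ones,
    ← Finset.sum_add_distrib]
  refine Finset.sum_congr rfl fun c _ => ?_
  rw [card_edgesWithin]
  exact IsTree.card_edgeFinset (G := G.induce c.supp) (hG.isTree_connectedComponent c)

theorem IsAcyclic.card_edgesWithin_add {G : SimpleGraph V} (hG : G.IsAcyclic) (W : Set V) :
    (G.edgesWithin W).card + Nat.card (G.induce W).ConnectedComponent = W.ncard := by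
  classical
  rw [card_edgesWithin, (hG.induce W).card_edgeFinset_add_card_connectedComponent,
    ← Nat.card_eq_fintype_card, Nat.card_coe_set_eq]

theorem disjoint_edgesWithin_compl (G : SimpleGraph V) (W : Set V) :
    Disjoint (G.edgesWithin W) (G.edgesWithin Wᶜ) := by
  refine Finset.disjoint_left.2 fun e => ?_
  induction e with | _ u v
  simp only [mk_mem_edgesWithin]
  exact fun h h' => h'.2.1 h.2.1

theorem IsAcyclic.exists_supp_eq_iff {G : SimpleGraph V} [Fintype G.edgeSet] [DecidableEq V]
    (hG : G.IsAcyclic) {S : Finset (Sym2 V)} (hS : S ⊆ G.edgeFinset) (W : Set V) :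
    (∃ c : (fromEdgeSet (S : Set (Sym2 V))).ConnectedComponent, c.supp = W) ↔
      (G.induce W).Connected ∧ G.edgesWithin W ⊆ S ∧
        S ⊆ G.edgesWithin W ∪ G.edgesWithin Wᶜ := by
  have hle : fromEdgeSet (S : Set (Sym2 V)) ≤ G := by
    intro u v h
    exact mem_edgeFinset.1 (hS (Finset.mem_coe.1 ((fromEdgeSet_adj _).1 h).1))
  have hadj : ∀ u v, s(u, v) ∈ S → (fromEdgeSet (S : Set (Sym2 V))).Adj u v := by
    intro u v h
    refine (fromEdgeSet_adj _).2 ⟨by simpa using h, ?_⟩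
    have : G.Adj u v := by simpa using hS h
    exact this.ne
  constructor
  · rintro ⟨c, rfl⟩
    refine ⟨c.connected_toSimpleGraph.mono ?_, ?_, ?_⟩
    · exact fun u v h => hle h
    · intro e
      induction e with | _ u v
      rw [mk_mem_edgesWithin]
      rintro ⟨h, hu, hv⟩
      by_contra hn
      have hb := isBridge_iff.1 (isAcyclic_iff_forall_adj_isBridge.1 hG h)
      refine hb ((c.reachable_of_mem_supp hu hv).mono ?_)
      intro x y hxy
      rw [deleteEdges_adj]
      refine ⟨hle hxy, fun he => hn ?_⟩
      rw [← Set.mem_singleton_iff.1 he]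
      simpa using ((fromEdgeSet_adj _).1 hxy).1
    · intro e
      induction e with | _ u v
      intro h
      rw [Finset.mem_union, mk_mem_edgesWithin, mk_mem_edgesWithin, Set.mem_compl_iff,
        Set.mem_compl_iff, c.mem_supp_congr_adj (hadj _ _ h)]
      have := hle (hadj _ _ h)
      tauto
  · rintro ⟨hc, h1, h2⟩
    rw [← ConnectedComponent.maximal_connected_induce_iff]
    have hWc : ((fromEdgeSet (S : Set (Sym2 V))).induce W).Connected := by
      refine hc.mono ?_
      intro u v h
      exact hadj _ _ (h1 (mk_mem_edgesWithin.2 ⟨h, u.2, v.2⟩))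
    refine ⟨hWc, fun W' hW' hsub v hv => ?_⟩
    obtain ⟨w, hw⟩ := hWc.nonempty
    obtain ⟨p⟩ := (hW'.preconnected ⟨w, hsub hw⟩ ⟨v, hv⟩).map (Embedding.induce W').toHom
    have key : ∀ {a b : V}, (fromEdgeSet (S : Set (Sym2 V))).Walk a b → a ∈ W → b ∈ W := by
      intro a b q
      induction q with
      | nil => exact id
      | cons h _ ih =>
        intro ha
        refine ih ?_
        have := h2 (show s(_, _) ∈ S by simpa using ((fromEdgeSet_adj _).1 h).1)
        rw [Finset.mem_union, mk_mem_edgesWithin, mk_mem_edgesWithin] at this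
        rcases this with h | h
        · exact h.2.2
        · exact absurd ha h.2.1
    exact key p hw

end SimpleGraph

theorem Finset.sum_powerset_neg_one_pow_mul_choose {α : Type*} [DecidableEq α] (F : Finset α)
    (k : ℕ) :
    ∑ R ∈ F.powerset, (-1 : ℤ) ^ R.card * (R.card.choose k : ℤ) =
      if F.card = k then (-1) ^ k else 0 := by
  induction F using Finset.induction_on generalizing k with
  | empty => cases k <;> simp
  | insert a F ha ih =>
    rw [Finset.sum_powerset_insert ha, Finset.card_insert_of_notMem ha, ← Finset.sum_add_distrib]
    have hc : ∀ R ∈ F.powerset, (insert a R).card = R.card + 1 := fun R hR =>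
      Finset.card_insert_of_notMem fun h => ha (Finset.mem_powerset.1 hR h)
    cases k with
    | zero =>
      rw [if_neg (by omega)]
      refine Finset.sum_eq_zero fun R hR => ?_
      rw [hc R hR]
      simp [pow_succ]
    | succ k =>
      have : ∀ R ∈ F.powerset, (-1 : ℤ) ^ R.card * (R.card.choose (k + 1) : ℤ) +
          (-1 : ℤ) ^ (insert a R).card * ((insert a R).card.choose (k + 1) : ℤ) =
          -((-1 : ℤ) ^ R.card * (R.card.choose k : ℤ)) := by
        intro R hR
        rw [hc R hR, Nat.choose_succ_succ]
        push_cast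
        ring
      rw [Finset.sum_congr rfl this, Finset.sum_neg_distrib, ih]
      simp only [Nat.add_right_cancel_iff, pow_succ]
      split_ifs <;> simp

theorem coeff_psum_eq_one_or_zero (d : ℕ →₀ ℕ) (k : ℕ) :
    MvPowerSeries.coeff d (psum k) = open scoped Classical in
      if ∃ i : ℕ, d = Finsupp.single i k then 1 else 0 := rfl

/-- The coefficients of `∏ a, p_{w a}` count the ways to distribute the factors over the
variables. -/
theorem coeff_prod_psum {ι : Type*} [Fintype ι] (w : ι → ℕ) (hw : ∀ a, 0 < w a) (d : ℕ →₀ ℕ) :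
    MvPowerSeries.coeff d (∏ a, psum (w a)) =
      ({g : ι → ℕ | ∀ k, ∑ a with g a = k, w a = d k}.ncard : ℤ) := by
  classical
  rw [MvPowerSeries.coeff_prod]
  simp only [coeff_psum_eq_one_or_zero, Finset.prod_boole, Finset.mem_univ, true_implies,
    Finset.sum_boole]
  norm_cast
  let Φ : (ι → ℕ) → ι →₀ ℕ →₀ ℕ := fun g =>
    Finsupp.equivFunOnFinite.symm fun a => Finsupp.single (g a) (w a)
  have hΦ : Function.Injective Φ := by
    intro g g' h
    funext a
    have := DFunLike.congr_fun h a
    exact Finsupp.single_left_injective (hw a).ne' this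
  rw [← Set.ncard_coe_finset, ← Set.ncard_image_of_injective _ hΦ]
  congr 1
  ext l
  simp only [Finset.coe_filter, Finset.mem_finsuppAntidiag, Set.mem_ofPred_eq, Set.mem_image,
    Finset.subset_univ, and_true]
  have hsum : ∀ g : ι → ℕ, (∑ a, Finsupp.single (g a) (w a) = d) ↔
      ∀ k, ∑ a with g a = k, w a = d k := by
    intro g
    rw [Finsupp.ext_iff]
    refine forall_congr' fun k => ?_
    rw [Finsupp.finsetSum_apply, Finset.sum_filter]
    simp only [Finsupp.single_apply]
  constructor
  · rintro ⟨h, hs⟩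
    choose g hg using hs
    refine ⟨g, (hsum g).1 ?_, ?_⟩
    · rw [← h]
      exact Finset.sum_congr rfl fun a _ => (hg a).symm
    · ext1 a
      exact (hg a).symm
  · rintro ⟨g, h, rfl⟩
    exact ⟨(hsum g).2 h, fun a => ⟨g a, rfl⟩⟩

theorem coeff_psum_nonneg (d : ℕ →₀ ℕ) (k : ℕ) : 0 ≤ MvPowerSeries.coeff d (psum k) := by
  rw [coeff_psum_eq_one_or_zero]
  split_ifs <;> simp

theorem pProd_cons (a : ℕ) (m : Multiset ℕ) : pProd (a ::ₘ m) = psum a * pProd m := by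
  simp [pProd]

theorem coeff_pProd_nonneg (m : Multiset ℕ) (d : ℕ →₀ ℕ) :
    0 ≤ MvPowerSeries.coeff d (pProd m) := by
  classical
  induction m using Multiset.induction_on generalizing d with
  | empty =>
    simp only [pProd, Multiset.map_zero, Multiset.prod_zero, MvPowerSeries.coeff_one]
    split_ifs <;> simp
  | cons a m ih =>
    rw [pProd_cons, MvPowerSeries.coeff_mul]
    exact Finset.sum_nonneg fun p _ => mul_nonneg (coeff_psum_nonneg _ _) (ih _)

/-- A monomial of `p_m` has at most as many variables as `m` has parts, and if it has exactly as
many then its exponents are the parts of `m`. -/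
theorem card_support_le_of_coeff_pProd_ne_zero {m : Multiset ℕ} {d : ℕ →₀ ℕ}
    (h : MvPowerSeries.coeff d (pProd m) ≠ 0) :
    d.support.card ≤ m.card ∧ (d.support.card = m.card → d.support.val.map d = m) := by
  classical
  induction m using Multiset.induction_on generalizing d with
  | empty =>
    simp only [pProd, Multiset.map_zero, Multiset.prod_zero, MvPowerSeries.coeff_one] at h
    have : d = 0 := by
      by_contra hd
      exact h (if_neg hd)
    simp [this]
  | cons a m ih =>
    rw [pProd_cons, MvPowerSeries.coeff_mul] at h
    obtain ⟨⟨e, e'⟩, he, hne⟩ := Finset.exists_ne_zero_of_sum_ne_zero h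
    obtain rfl := Finset.HasAntidiagonal.mem_antidiagonal.1 he
    have h1 := left_ne_zero_of_mul hne
    have h2 := right_ne_zero_of_mul hne
    rw [coeff_psum_eq_one_or_zero] at h1
    obtain ⟨i, rfl⟩ : ∃ i, e = Finsupp.single i a := by
      by_contra hc
      exact h1 (if_neg hc)
    dsimp only at h2 ⊢
    obtain ⟨hle, heq⟩ := ih h2
    have hsub : (Finsupp.single i a + e').support ⊆ insert i e'.support := by
      refine Finsupp.support_add.trans ?_
      rw [Finset.insert_eq]
      exact Finset.union_subset_union Finsupp.support_single_subset subset_rfl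
    have hcard := Finset.card_le_card hsub
    have hins := Finset.card_insert_le i e'.support
    rw [Multiset.card_cons]
    refine ⟨by omega, fun hd => ?_⟩
    have hi : i ∉ e'.support := by
      intro hi
      rw [Finset.insert_eq_of_mem hi] at hcard
      omega
    have hs := Finset.eq_of_subset_of_card_le hsub (by omega)
    rw [hs, Finset.insert_val_of_notMem hi, Multiset.map_cons, ← heq (by omega)]
    rw [Finsupp.notMem_support_iff] at hi
    congr 1
    · simp [hi]
    · refine Multiset.map_congr rfl fun x hx => ?_
      have : i ≠ x := by
        rintro rfl
        exact Finsupp.mem_support_iff.1 hx hi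
      simp [this]

theorem exists_coeff_pProd_pos {m : Multiset ℕ} (hm : ∀ a ∈ m, 0 < a) :
    ∃ d : ℕ →₀ ℕ, d.support.val.map d = m ∧ 0 < MvPowerSeries.coeff d (pProd m) := by
  classical
  induction m using Multiset.induction_on with
  | empty => exact ⟨0, by simp, by simp [pProd]⟩
  | cons a m ih =>
    obtain ⟨d, hd, hpos⟩ := ih fun b hb => hm b (Multiset.mem_cons_of_mem hb)
    obtain ⟨i, hi⟩ := Infinite.exists_notMem_finset d.support
    have ha : a ≠ 0 := (hm a (Multiset.mem_cons_self a m)).ne'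
    have hs : (Finsupp.single i a + d).support = insert i d.support := by
      rw [Finsupp.support_add_eq, Finsupp.support_single _ ha, Finset.insert_eq]
      rw [Finsupp.support_single _ ha]
      exact Finset.disjoint_singleton_left.2 hi
    refine ⟨Finsupp.single i a + d, ?_, ?_⟩
    · rw [hs, Finset.insert_val_of_notMem hi, Multiset.map_cons, ← hd]
      rw [Finsupp.notMem_support_iff] at hi
      congr 1
      · simp [hi]
      · refine Multiset.map_congr rfl fun x hx => ?_
        have : i ≠ x := by
          rintro rfl
          exact Finsupp.mem_support_iff.1 hx hi
        simp [this]
    · rw [pProd_cons, MvPowerSeries.coeff_mul]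
      refine Finset.sum_pos' (fun p _ => mul_nonneg (coeff_psum_nonneg _ _)
        (coeff_pProd_nonneg _ _)) ⟨(Finsupp.single i a, d), by simp, ?_⟩
      refine mul_pos ?_ hpos
      rw [coeff_psum_eq_one_or_zero, if_pos ⟨i, rfl⟩]
      exact one_pos

/-- The power sum products `p_λ`, for `λ` a partition of `n`, are linearly independent. -/
theorem linearIndependent_pProd (n : ℕ) :
    LinearIndependent ℤ fun lam : n.Partition => pProd lam.parts := by
  classical
  rw [Fintype.linearIndependent_iff]
  intro a ha
  by_contra! hne
  obtain ⟨lam, hlam, hmax⟩ := Finset.exists_max_image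
    (Finset.univ.filter fun lam : n.Partition => a lam ≠ 0) (fun lam => lam.parts.card)
    (by simpa [Finset.Nonempty] using hne)
  simp only [Finset.mem_filter, Finset.mem_univ, true_and] at hlam hmax
  obtain ⟨d, hd, hpos⟩ := exists_coeff_pProd_pos (m := lam.parts) fun _ h => lam.parts_pos h
  have hcoeff := congrArg (MvPowerSeries.coeff d) ha
  rw [map_sum, Finset.sum_eq_single lam] at hcoeff
  · rw [map_zsmul, map_zero, smul_eq_mul] at hcoeff
    exact (mul_ne_zero hlam hpos.ne') hcoeff
  · intro mu _ hmu
    rw [map_zsmul, smul_eq_mul, mul_eq_zero, or_iff_not_imp_left]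
    intro hamu
    by_contra hc
    obtain ⟨hle, heq⟩ := card_support_le_of_coeff_pProd_ne_zero hc
    have hcard : d.support.card = lam.parts.card := by
      rw [← hd, Multiset.card_map, Finset.card_def]
    have := hmax mu hamu
    exact hmu (Nat.Partition.ext ((heq (by omega)).symm.trans hd))
  · simp

section Coloring

variable {V : Type*} [Fintype V]

open scoped Classical in
/-- The multiset of sizes of the connected components of `G`. -/
noncomputable def componentSizes (G : SimpleGraph V) : Multiset ℕ :=
  Finset.univ.val.map fun c : G.ConnectedComponent => c.supp.ncard

theorem pProd_componentSizes (G : SimpleGraph V) [Fintype G.ConnectedComponent] :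
    pProd (componentSizes G) = ∏ c : G.ConnectedComponent, psum c.supp.ncard := by
  rw [pProd, componentSizes, Multiset.map_map]
  rw [Finset.prod_eq_multiset_prod]
  congr!

theorem card_componentSizes (G : SimpleGraph V) :
    (componentSizes G).card = Nat.card G.ConnectedComponent := by
  classical
  rw [componentSizes, Multiset.card_map, Nat.card_eq_fintype_card]
  rfl

theorem sum_componentSizes (G : SimpleGraph V) :
    (componentSizes G).sum = Fintype.card V := by
  classical
  rw [← Finset.card_univ, Finset.card_eq_sum_card_fiberwise
    (f := G.connectedComponentMk) (t := Finset.univ) (by simp)]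
  refine Finset.sum_congr rfl fun c _ => ?_
  rw [← Set.ncard_coe_finset]
  congr 1
  ext v
  simp

theorem count_componentSizes (G : SimpleGraph V) (i : ℕ) [DecidableEq (Set V)]
    [∀ W : Set V, Decidable (∃ c : G.ConnectedComponent, c.supp = W)] :
    (componentSizes G).count i = (Finset.univ.filter fun W : Set V =>
      W.ncard = i ∧ ∃ c : G.ConnectedComponent, c.supp = W).card := by
  classical
  rw [componentSizes, Multiset.count_map, ← Finset.filter_val, ← Finset.card_def,
    ← Finset.card_image_of_injective _ ConnectedComponent.supp_injective]
  congr 1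
  ext W
  simp only [Finset.mem_image, Finset.mem_filter, Finset.mem_univ, true_and]
  constructor
  · rintro ⟨c, h, rfl⟩
    exact ⟨h.symm, c, rfl⟩
  · rintro ⟨h, c, rfl⟩
    exact ⟨c, h.symm, rfl⟩

/-- The partition of `Fintype.card V` into the sizes of the connected components of `G`. -/
noncomputable def componentPartition (G : SimpleGraph V) {n : ℕ} (hn : Fintype.card V = n) :
    n.Partition where
  parts := componentSizes G
  parts_pos := by
    intro i hi
    obtain ⟨c, _, rfl⟩ := Multiset.mem_map.1 hi
    exact (Set.ncard_pos).2 c.nonempty_supp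
  parts_sum := (sum_componentSizes G).trans hn

theorem coeff_pProd_componentSizes (G : SimpleGraph V) (d : ℕ →₀ ℕ) :
    MvPowerSeries.coeff d (pProd (componentSizes G)) =
      ({k : V → ℕ | (∀ i, {v | k v = i}.ncard = d i) ∧
        ∀ u v, G.Adj u v → k u = k v}.ncard : ℤ) := by
  classical
  rw [pProd_componentSizes, coeff_prod_psum _ fun c => (Set.ncard_pos).2 c.nonempty_supp]
  have hinj : Function.Injective fun (g : G.ConnectedComponent → ℕ) (v : V) =>
      g (G.connectedComponentMk v) := by
    intro g g' h
    funext c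
    obtain ⟨v, rfl⟩ := c.exists_rep
    exact congrFun h v
  rw [← Set.ncard_image_of_injective _ hinj]
  congr 2
  have hcount : ∀ (g : G.ConnectedComponent → ℕ) (i : ℕ),
      ∑ c with g c = i, c.supp.ncard = {v | g (G.connectedComponentMk v) = i}.ncard := by
    intro g i
    rw [Set.ncard_eq_toFinset_card', Finset.card_eq_sum_card_fiberwise
      (f := G.connectedComponentMk) (t := Finset.univ.filter fun c => g c = i)
      (fun v hv => by simpa using hv)]
    refine Finset.sum_congr rfl fun c hc => ?_
    rw [Set.ncard_eq_toFinset_card']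
    congr 1
    ext v
    simp only [Finset.mem_filter, Finset.mem_univ, true_and] at hc
    simp only [Set.mem_toFinset, ConnectedComponent.mem_supp_iff, Finset.mem_filter,
      Set.mem_ofPred_eq]
    exact ⟨fun h => ⟨h ▸ hc, h⟩, fun h => h.2⟩
  ext k
  simp only [Set.mem_image, Set.mem_ofPred_eq]
  constructor
  · rintro ⟨g, hg, rfl⟩
    exact ⟨fun i => by rw [← hcount, hg],
      fun u v h => congrArg g (ConnectedComponent.sound h.reachable)⟩
  · rintro ⟨hk, hS⟩
    have hr : ∀ u v, G.Walk u v → k u = k v := by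
      intro u v p
      induction p with
      | nil => rfl
      | cons h _ ih => rw [← ih, hS _ _ h]
    refine ⟨fun c => c.lift k fun u v p _ => hr u v p, fun i => ?_, rfl⟩
    exact (hcount (fun c => c.lift k fun u v p _ => hr u v p) i).trans (hk i)

theorem csf_eq_sum_pProd (G : SimpleGraph V) [Fintype G.edgeSet] :
    csf G = ∑ S ∈ G.edgeFinset.powerset,
      (-1 : ℤ) ^ S.card • pProd (componentSizes (fromEdgeSet (S : Set (Sym2 V)))) := by
  classical
  ext d
  rw [map_sum]
  simp only [map_zsmul, coeff_pProd_componentSizes, smul_eq_mul]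
  let K : Finset (V → ℕ) :=
    (Fintype.piFinset fun _ : V => d.support).filter fun k => ∀ i, {v | k v = i}.ncard = d i
  have hK : ∀ k, k ∈ K ↔ ∀ i, {v | k v = i}.ncard = d i := by
    intro k
    simp only [K, Finset.mem_filter, Fintype.mem_piFinset, Finsupp.mem_support_iff,
      and_iff_right_iff_imp]
    intro h v
    rw [← h]
    exact ((Set.ncard_pos (s := {u | k u = k v})).2 ⟨v, rfl⟩).ne'
  have hleft : MvPowerSeries.coeff d (csf G) =
      ∑ k ∈ K, if ∀ e ∈ G.edgeFinset, ¬(e.map k).IsDiag then (1 : ℤ) else 0 := by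
    rw [Finset.sum_boole, ← Set.ncard_coe_finset]
    change ((Nat.card _ : ℕ) : ℤ) = _
    rw [Nat.card_coe_set_eq]
    congr 2
    ext k
    have hone : ∀ i, ∑ᶠ v ∈ {v | k v = i}, 1 = {v | k v = i}.ncard := by
      exact fun i => finsum_one
    rw [Set.mem_ofPred_eq, Finset.coe_filter, Set.mem_ofPred_eq, hK, and_comm]
    simp only [hone]
    refine and_congr Iff.rfl ⟨fun h e he => ?_, fun h u v huv => ?_⟩
    · induction e with | _ u v
      simpa using h u v (mem_edgeFinset.1 he)
    · simpa using h _ (mem_edgeFinset.2 huv)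
  have hright : ∀ S : Finset (Sym2 V), ({k : V → ℕ | (∀ i, {v | k v = i}.ncard = d i) ∧
      ∀ u v, (fromEdgeSet (S : Set (Sym2 V))).Adj u v → k u = k v}.ncard : ℤ) =
        ∑ k ∈ K, if ∀ e ∈ S, (e.map k).IsDiag then (1 : ℤ) else 0 := by
    intro S
    rw [Finset.sum_boole, ← Set.ncard_coe_finset]
    congr 2
    ext k
    rw [Set.mem_ofPred_eq, Finset.coe_filter, Set.mem_ofPred_eq, hK]
    refine and_congr Iff.rfl ⟨fun h e he => ?_, fun h u v huv => ?_⟩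
    · induction e with | _ u v
      rw [Sym2.map_mk, Sym2.mk_isDiag_iff]
      by_cases huv : u = v
      · rw [huv]
      · exact h u v ((fromEdgeSet_adj _).2 ⟨he, huv⟩)
    · simpa using h _ (Finset.mem_coe.1 ((fromEdgeSet_adj _).1 huv).1)
  rw [hleft]
  simp only [hright, Finset.mul_sum]
  rw [Finset.sum_comm]
  refine Finset.sum_congr rfl fun k _ => ?_
  calc (if ∀ e ∈ G.edgeFinset, ¬(e.map k).IsDiag then (1 : ℤ) else 0)
      = ∏ e ∈ G.edgeFinset, if ¬(e.map k).IsDiag then (1 : ℤ) else 0 := by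
        rw [Finset.prod_boole]
        congr
    _ = ∏ e ∈ G.edgeFinset, (1 + -if (e.map k).IsDiag then (1 : ℤ) else 0) := by
        refine Finset.prod_congr rfl fun e _ => ?_
        by_cases h : (e.map k).IsDiag <;> simp [h]
    _ = _ := by
        rw [Finset.prod_one_add]
        refine Finset.sum_congr rfl fun S _ => ?_
        rw [Finset.prod_neg, Finset.prod_boole]
        congr 1
        congr

end Coloring

/-- The coefficients of the power sum expansion of `csf G` are signed counts of edge sets. -/
theorem eq_sum_of_csf_eq {V : Type*} [Fintype V] (G : SimpleGraph V) [Fintype G.edgeSet]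
    {n : ℕ} (hn : Fintype.card V = n) (c : n.Partition → ℤ)
    (hX : csf G = ∑ lam : n.Partition, c lam • pProd lam.parts) (lam : n.Partition) :
    c lam = ∑ S ∈ G.edgeFinset.powerset with
      componentPartition (fromEdgeSet (SetLike.coe S)) hn = lam, (-1 : ℤ) ^ S.card := by
  revert lam
  rw [← funext_iff]
  refine (linearIndependent_pProd n).fintypeLinearCombination_injective ?_
  rw [Fintype.linearCombination_apply, Fintype.linearCombination_apply, ← hX,
    csf_eq_sum_pProd, ← Finset.sum_fiberwise _ fun S : Finset (Sym2 V) =>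
      componentPartition (fromEdgeSet (S : Set (Sym2 V))) hn]
  refine Finset.sum_congr rfl fun lam _ => ?_
  rw [Finset.sum_smul]
  refine Finset.sum_congr rfl fun S hS => ?_
  rw [← (Finset.mem_filter.1 hS).2]
  rfl

open scoped Classical in
theorem fT_eq_card {V : Type*} [Fintype V] (T : SimpleGraph V) (i j : ℕ) :
    fT T i j = (Finset.univ.filter fun W : Set V => W.ncard = i ∧ (T.induce W).Connected ∧
      Nat.card (T.induce Wᶜ).ConnectedComponent = j).card := by
  rw [fT, Nat.card_coe_set_eq, ← Set.ncard_coe_finset]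
  congr 1
  ext W
  simp

/-- Summing over the edge sets of which `W` is a component isolates the subtrees `W` whose
complement has `j` components. -/
theorem SimpleGraph.IsAcyclic.sum_edgeSets_with_component {V : Type*} [Fintype V]
    [DecidableEq V] {T : SimpleGraph V} [Fintype T.edgeSet] (hT : T.IsAcyclic)
    {n i j : ℕ} (hn : Fintype.card V = n) (hi : 1 ≤ i) (hin : i ≤ n) (hj : j ≤ n - i)
    {W : Set V} (hW : W.ncard = i) (hconn : (T.induce W).Connected) :
    ∑ S ∈ T.edgeFinset.powerset with
        T.edgesWithin W ⊆ S ∧ S ⊆ T.edgesWithin W ∪ T.edgesWithin Wᶜ,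
      (-1 : ℤ) ^ S.card * (if n - S.card ≤ j + 1 then
        (-1 : ℤ) ^ (n - j - 1) *
          ((n + 1 - i - (n - S.card)).choose (j + 1 - (n - S.card)) : ℤ) else 0) =
      if Nat.card (T.induce Wᶜ).ConnectedComponent = j then 1 else 0 := by
  have hA : (T.edgesWithin W).card + 1 = i := by
    have h := hT.card_edgesWithin_add W
    have := hconn.preconnected.subsingleton_connectedComponent
    have := hconn.nonempty
    rwa [Nat.card_unique, hW] at h
  have hF := hT.card_edgesWithin_add Wᶜ
  have hWc : Wᶜ.ncard = n - i := by
    rw [Set.ncard_compl, hW, Nat.card_eq_fintype_card, hn]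
  rw [hWc] at hF
  set A := T.edgesWithin W
  set F := T.edgesWithin Wᶜ
  have hdisj : Disjoint A F := T.disjoint_edgesWithin_compl W
  have hsub : A ∪ F ⊆ T.edgeFinset := by
    refine Finset.union_subset ?_ ?_ <;>
    · intro e
      induction e with | _ u v
      intro h
      exact mem_edgeFinset.2 (mk_mem_edgesWithin.1 h).1
  have himage : T.edgeFinset.powerset.filter (fun S => A ⊆ S ∧ S ⊆ A ∪ F) =
      F.powerset.image (A ∪ ·) := by
    rw [← Finset.union_sdiff_cancel_left hdisj, ← Finset.Icc_eq_image_powerset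
      Finset.subset_union_left]
    ext S
    simp only [Finset.mem_filter, Finset.mem_powerset, Finset.mem_Icc,
      Finset.union_sdiff_cancel_left hdisj, and_iff_right_iff_imp]
    exact fun h => h.2.trans hsub
  have hdisjR : ∀ R ∈ F.powerset, Disjoint A R := fun R hR =>
    hdisj.mono_right (Finset.mem_powerset.1 hR)
  rw [himage, Finset.sum_image]
  · have hterm : ∀ R ∈ F.powerset, (-1 : ℤ) ^ (A ∪ R).card * (if n - (A ∪ R).card ≤ j + 1 then
        (-1 : ℤ) ^ (n - j - 1) *
          ((n + 1 - i - (n - (A ∪ R).card)).choose (j + 1 - (n - (A ∪ R).card)) : ℤ) else 0) =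
        (-1) ^ (n - i - j) * ((-1) ^ R.card * (R.card.choose (n - i - j) : ℤ)) := by
      intro R hR
      have hRF := Finset.card_le_card (Finset.mem_powerset.1 hR)
      rw [Finset.card_union_of_disjoint (hdisjR R hR)]
      split_ifs with h
      · have h1 : n + 1 - i - (n - (A.card + R.card)) = R.card := by omega
        have h2 : j + 1 - (n - (A.card + R.card)) = R.card - (n - i - j) := by omega
        have h3 : n - j - 1 = A.card + (n - i - j) := by omega
        rw [h1, h2, h3, Nat.choose_symm (by omega), pow_add, pow_add]
        have h4 : (-1 : ℤ) ^ A.card * (-1) ^ A.card = 1 := by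
          rw [← mul_pow]
          simp
        linear_combination ((-1 : ℤ) ^ R.card * (-1) ^ (n - i - j) *
          (R.card.choose (n - i - j) : ℤ)) * h4
      · rw [Nat.choose_eq_zero_of_lt (by omega)]
        simp
    rw [Finset.sum_congr rfl hterm, ← Finset.mul_sum,
      Finset.sum_powerset_neg_one_pow_mul_choose]
    have hiff : F.card = n - i - j ↔ Nat.card (T.induce Wᶜ).ConnectedComponent = j := by omega
    simp only [hiff]
    split_ifs
    · rw [← mul_pow]
      simp
    · simp
  · intro R hR R' hR' h
    have := congrArg (· \ A) h
    simpa only [Finset.union_sdiff_cancel_left (hdisjR R hR),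
      Finset.union_sdiff_cancel_left (hdisjR R' hR')] using this

/-- for a tree `T` on `n` vertices with `X_T = Σ c_lam p_lam`,
`f_T(i,j) = Σ_lam σ(lam,i,j) c_lam` where
`σ(lam,i,j) = (-1)^(n-j-1) C(n-i-l(lam)+1, j-l(lam)+1) m_i(lam)`. -/
theorem stmt14 {V : Type*} [Fintype V] (T : SimpleGraph V)
    (hc : T.Connected) (ha : T.IsAcyclic)
    (n : Nat) (hn : Fintype.card V = n)
    (c : n.Partition → Int)
    (hX : csf T = ∑ᶠ lam : n.Partition, c lam • pProd lam.parts)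
    (i j : Nat) (hi : 1 ≤ i) (hin : i ≤ n) (hj : j ≤ n - i) :
    (fT T i j : Int) = ∑ᶠ lam : n.Partition,
      (if lam.parts.card ≤ j + 1 then
          (-1 : Int) ^ (n - j - 1) *
            ((n + 1 - i - lam.parts.card).choose (j + 1 - lam.parts.card) : Int) *
            (lam.parts.count i : Int)
        else 0) * c lam := by
  classical
  rw [finsum_eq_sum_of_fintype] at hX ⊢
  have hl : ∀ S ∈ T.edgeFinset.powerset,
      (componentSizes (fromEdgeSet (S : Set (Sym2 V)))).card = n - S.card := by
    intro S hS
    have hS' := Finset.mem_powerset.1 hS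
    have hle : fromEdgeSet (S : Set (Sym2 V)) ≤ T := by
      intro u v h
      exact mem_edgeFinset.1 (hS' (Finset.mem_coe.1 ((fromEdgeSet_adj _).1 h).1))
    have hcard := (ha.anti hle).card_edgeFinset_add_card_connectedComponent
    have hedge : (fromEdgeSet (S : Set (Sym2 V))).edgeFinset = S := by
      ext e
      rw [mem_edgeFinset, edgeSet_fromEdgeSet]
      simp only [Set.mem_sdiff, Finset.mem_coe, and_iff_left_iff_imp]
      exact fun he => T.not_isDiag_of_mem_edgeFinset (hS' he)
    rw [hedge, hn] at hcard
    rw [card_componentSizes]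
    omega
  let τ : ℕ → ℤ := fun l => if l ≤ j + 1 then
    (-1 : ℤ) ^ (n - j - 1) * ((n + 1 - i - l).choose (j + 1 - l) : ℤ) else 0
  have hτ : ∀ m : Multiset ℕ, (if m.card ≤ j + 1 then
      (-1 : ℤ) ^ (n - j - 1) * ((n + 1 - i - m.card).choose (j + 1 - m.card) : ℤ) *
        (m.count i : ℤ) else 0) = τ m.card * (m.count i : ℤ) := by
    intro m
    simp only [τ, ite_mul, zero_mul]
  symm
  calc _ = ∑ lam : n.Partition, ∑ S ∈ T.edgeFinset.powerset with
          componentPartition (fromEdgeSet (SetLike.coe S)) hn = lam,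
          (-1 : ℤ) ^ S.card * (τ (n - S.card) *
            ((componentSizes (fromEdgeSet (S : Set (Sym2 V)))).count i : ℤ)) := by
        refine Finset.sum_congr rfl fun lam _ => ?_
        rw [hτ, eq_sum_of_csf_eq T hn c hX lam, Finset.mul_sum]
        refine Finset.sum_congr rfl fun S hS => ?_
        rw [Finset.mem_filter] at hS
        rw [← hl S hS.1, ← hS.2, mul_comm]
        rfl
    _ = ∑ S ∈ T.edgeFinset.powerset, (-1 : ℤ) ^ S.card * (τ (n - S.card) *
          ((componentSizes (fromEdgeSet (S : Set (Sym2 V)))).count i : ℤ)) :=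
        Finset.sum_fiberwise _ _ _
    _ = ∑ S ∈ T.edgeFinset.powerset, ∑ W : Set V,
          if W.ncard = i ∧ (T.induce W).Connected ∧ T.edgesWithin W ⊆ S ∧
            S ⊆ T.edgesWithin W ∪ T.edgesWithin Wᶜ
          then (-1 : ℤ) ^ S.card * τ (n - S.card) else 0 := by
        refine Finset.sum_congr rfl fun S hS => ?_
        rw [count_componentSizes, ← mul_assoc, Finset.card_filter]
        push_cast
        rw [Finset.mul_sum]
        refine Finset.sum_congr rfl fun W _ => ?_
        rw [mul_ite, mul_one, mul_zero]
        exact if_congr (and_congr Iff.rfl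
          (ha.exists_supp_eq_iff (Finset.mem_powerset.1 hS) W)) rfl rfl
    _ = ∑ W : Set V, if W.ncard = i ∧ (T.induce W).Connected ∧
          Nat.card (T.induce Wᶜ).ConnectedComponent = j then 1 else 0 := by
        rw [Finset.sum_comm]
        refine Finset.sum_congr rfl fun W _ => ?_
        by_cases hW : W.ncard = i ∧ (T.induce W).Connected
        · simp only [hW.1, hW.2, true_and]
          rw [← Finset.sum_filter]
          exact ha.sum_edgeSets_with_component hn hi hin hj hW.1 hW.2
        · rw [if_neg fun h => hW ⟨h.1, h.2.1⟩]
          exact Finset.sum_eq_zero fun S _ => if_neg fun h => hW ⟨h.1, h.2.1⟩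
    _ = _ := by
        rw [fT_eq_card, Finset.card_filter]
        push_cast
        rfl
end

section
/- The polynomial F_T(x,y) = Σ_H x^{|H|} y^{d(V(H))}, summed over all subtrees H of a tree T, is determined by the chromatic symmetric function X_T; that is, if two trees T and T' satisfy X_T = X_{T'}, then F_T = F_{T'}. -/
open SimpleGraph

/-- The polynomial `F_T(x,y) = Σ_H x^(|H|) y^(d(V(H)))`, summed over all subtrees `H` of `T`,
where `d(V(H))` is the number of components of `T - V(H)`.  (`x = X 0`, `y = X 1`.) -/
noncomputable def FPoly {V : Type*} [Finite V] (T : SimpleGraph V) : MvPolynomial (Fin 2) Int :=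
  ∑ᶠ W ∈ {W : Set V | (T.induce W).Connected},
    (MvPolynomial.X 0) ^ (W.ncard) *
      (MvPolynomial.X 1) ^ (Nat.card (T.induce Wᶜ).ConnectedComponent)

namespace SimpleGraph

/-- A coloring of `G` amounts to a coloring of the complement of a leaf `v` together with a color
for `v` avoiding the color of its only neighbor. -/
noncomputable def coloringEquivOfLeaf {V α : Type*} (G : SimpleGraph V) {v u : V}
    (huv : G.Adj v u) (hu : ∀ w, G.Adj v w → w = u) :
    G.Coloring α ≃ Σ c : (G.induce {v}ᶜ).Coloring α, {x // x ≠ c ⟨u, huv.ne'⟩} :=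
  Equiv.ofBijective
    (fun c ↦ ⟨c.comp (Embedding.induce _).toHom, c v, c.valid huv⟩) <| by
    classical
    constructor
    · intro c d h
      simp only [Sigma.mk.injEq] at h
      obtain ⟨h1, h2⟩ := h
      ext w
      by_cases hw : w = v
      · subst hw
        have hcd : c u = d u := DFunLike.congr_fun h1 ⟨u, huv.ne'⟩
        rw [Subtype.heq_iff_coe_eq (by simp [hcd])] at h2
        exact h2
      · exact DFunLike.congr_fun h1 ⟨w, hw⟩
    · rintro ⟨c, x, hx⟩
      obtain ⟨g, rfl, rfl⟩ : ∃ g : G.Coloring α,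
          g.comp (Embedding.induce {v}ᶜ).toHom = c ∧ g v = x := by
        refine ⟨Coloring.mk (fun w ↦ if h : w = v then x else c ⟨w, h⟩) ?_, ?_, ?_⟩
        · intro y z hyz
          by_cases hy : y = v <;> by_cases hz : z = v
          · subst hy; subst hz; exact (hyz.ne rfl).elim
          · subst hy
            obtain rfl := hu z hyz
            simpa [hz] using hx
          · subst hz
            obtain rfl := hu y hyz.symm
            simpa [hy] using hx.symm
          · simpa [hy, hz] using c.valid (v := ⟨y, hy⟩) (w := ⟨z, hz⟩) hyz
        · ext ⟨w, hw⟩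
          exact dif_neg hw
        · exact dif_pos rfl
      exact ⟨g, rfl⟩

theorem IsTree.card_coloring {V : Type*} [Finite V] {T : SimpleGraph V} (hT : T.IsTree) (a : ℕ) :
    Nat.card (T.Coloring (Fin a)) = a * (a - 1) ^ (Nat.card V - 1) := by
  classical
  induction hn : Nat.card V generalizing V with
  | zero =>
    have := hT.connected.nonempty
    exact (Nat.card_pos.ne' hn).elim
  | succ n ih =>
    cases nonempty_fintype V
    rcases subsingleton_or_nontrivial V with hV | hV
    · obtain ⟨v⟩ := hT.connected.nonempty
      have h1 : Nat.card V = 1 := Nat.card_eq_one_iff_unique.2 ⟨hV, ⟨v⟩⟩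
      have e : T.Coloring (Fin a) ≃ Fin a :=
        { toFun c := c v
          invFun x := Coloring.mk (fun _ ↦ x) fun {x y} h ↦ (h.ne (Subsingleton.elim _ _)).elim
          left_inv c := by ext w; simp [Coloring.mk, Subsingleton.elim w v]
          right_inv x := rfl }
      obtain rfl : n = 0 := by omega
      rw [Nat.card_congr e]; simp
    · obtain ⟨v, hv⟩ := hT.exists_vert_degree_one_of_nontrivial
      have hT' : (T.induce {v}ᶜ).IsTree :=
        ⟨hT.connected.induce_compl_singleton_of_degree_eq_one hv, hT.isAcyclic.induce _⟩
      obtain ⟨u, hvu, hu⟩ := degree_eq_one_iff_existsUnique_adj.mp hv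
      have hc : Nat.card ({v}ᶜ : Set V) = n := by
        rw [Nat.card_coe_set_eq, Set.ncard_compl, hn]; simp
      have hn0 : 0 < n := by
        have : 1 < Nat.card V := Finite.one_lt_card
        omega
      rw [Nat.card_congr (coloringEquivOfLeaf T hvu hu), Nat.card_sigma]
      have (x : Fin a) : Nat.card {y // y ≠ x} = a - 1 := by
        simp [Fintype.card_subtype_compl]
      simp only [this, Finset.sum_const, Finset.card_univ, smul_eq_mul, ← Nat.card_eq_fintype_card]
      rw [ih hT' hc, mul_assoc, ← pow_succ]
      congr 2; omega

/-- Coloring a graph amounts to coloring its components. -/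
def coloringEquivPi {V α : Type*} (G : SimpleGraph V) :
    G.Coloring α ≃ ∀ c : G.ConnectedComponent, c.toSimpleGraph.Coloring α where
  toFun f c := f.comp c.toSimpleGraph_hom
  invFun f := homOfConnectedComponents G f
  left_inv f := rfl
  right_inv f := by
    ext c ⟨v, rfl⟩
    rfl

theorem card_eq_sum_card_supp {V : Type*} [Finite V] (G : SimpleGraph V)
    [Fintype G.ConnectedComponent] :
    Nat.card V = ∑ c : G.ConnectedComponent, Nat.card c.supp := by
  rw [← Nat.card_sigma]
  exact Nat.card_congr (Equiv.sigmaFiberEquiv G.connectedComponentMk).symm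

theorem card_connectedComponent_le {V : Type*} [Finite V] (G : SimpleGraph V) :
    Nat.card G.ConnectedComponent ≤ Nat.card V :=
  Nat.card_le_card_of_surjective G.connectedComponentMk Quot.mk_surjective

theorem IsAcyclic.card_coloring {V : Type*} [Finite V] {G : SimpleGraph V} (hG : G.IsAcyclic)
    (a : ℕ) : Nat.card (G.Coloring (Fin a)) =
      a ^ Nat.card G.ConnectedComponent * (a - 1) ^ (Nat.card V - Nat.card G.ConnectedComponent) := by
  cases nonempty_fintype G.ConnectedComponent
  have hc (c : G.ConnectedComponent) : Nat.card (c.toSimpleGraph.Coloring (Fin a)) =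
      a * (a - 1) ^ (Nat.card c.supp - 1) := (hG.isTree_connectedComponent c).card_coloring a
  rw [Nat.card_congr G.coloringEquivPi, Nat.card_pi]
  simp only [hc, Finset.prod_mul_distrib, Finset.prod_pow_eq_pow_sum, Finset.prod_const,
    Finset.card_univ, ← Nat.card_eq_fintype_card]
  congr 2
  rw [Finset.sum_tsub_distrib, ← G.card_eq_sum_card_supp]
  · simp
  · intro c _
    have := c.nonempty_supp.to_subtype
    exact Nat.card_pos

section Content

variable {V W : Type*} [Finite V] [Finite W]

/-- The exponent vector of the monomial attached to a coloring: color `i` is used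
`colorContent k i` times. -/
noncomputable def colorContent (k : V → ℕ) : ℕ →₀ ℕ :=
  Finsupp.ofSupportFinite (fun i ↦ {v | k v = i}.ncard) <|
    (Set.finite_range k).subset fun i hi ↦ by
      obtain ⟨v, hv⟩ := Set.nonempty_of_ncard_ne_zero hi
      exact ⟨v, hv⟩

theorem colorContent_apply (k : V → ℕ) (i : ℕ) : colorContent k i = {v | k v = i}.ncard := rfl

theorem colorContent_ne_zero_iff (k : V → ℕ) (i : ℕ) :
    colorContent k i ≠ 0 ↔ ∃ v, k v = i := by
  rw [colorContent_apply, ← Nat.pos_iff_ne_zero, Set.ncard_pos]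
  rfl

theorem sum_colorContent (k : V → ℕ) (s : Finset ℕ) :
    ∑ i ∈ s, colorContent k i = {v | k v ∈ s}.ncard := by
  classical
  cases nonempty_fintype V
  simp only [colorContent_apply, Set.ncard_eq_toFinset_card', Set.toFinset_ofPred]
  rw [Finset.card_eq_sum_card_fiberwise (f := k) (t := s) (by intro x; simp)]
  refine Finset.sum_congr rfl fun i hi ↦ congrArg _ ?_
  ext v
  simp only [Finset.mem_filter, Finset.mem_univ, true_and]
  grind

theorem sum_colorContent_support (k : V → ℕ) :
    ∑ i ∈ (colorContent k).support, colorContent k i = Nat.card V := by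
  rw [sum_colorContent, ← Set.ncard_univ]
  congr 1
  ext v
  simp only [Finsupp.mem_support_iff, colorContent_ne_zero_iff]
  simp

instance finite_colorContent_fiber (p : (V → ℕ) → Prop) (d : ℕ →₀ ℕ) :
    Finite {k : {k : V → ℕ // p k} // colorContent k.1 = d} := by
  refine Finite.of_injective
    (fun k v ↦ (⟨k.1.1 v, ?_⟩ : d.support)) fun k l h ↦ ?_
  · simpa only [← k.2, Finsupp.mem_support_iff] using (colorContent_ne_zero_iff _ _).2 ⟨v, rfl⟩
  · ext v
    exact congrArg Subtype.val (congrFun h v)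

theorem csf_apply (G : SimpleGraph V) (d : ℕ →₀ ℕ) :
    csf G d = Nat.card {k : {k : V → ℕ // ProperCol G.edgeSet k} // colorContent k.1 = d} := by
  rw [csf, csfW]
  congr 1
  refine Nat.card_congr ((Equiv.subtypeEquivRight fun k ↦ ?_).trans
    (Equiv.subtypeSubtypeEquivSubtypeInter (fun k : V → ℕ ↦ ProperCol G.edgeSet k)
      fun k ↦ colorContent k = d).symm)
  rw [Finsupp.ext_iff]
  exact and_congr_right fun _ ↦ forall_congr' fun i ↦ by
    rw [finsum_one, colorContent_apply]

theorem exists_equiv_of_csf_eq {G : SimpleGraph V} {G' : SimpleGraph W} (h : csf G = csf G') :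
    ∃ e : {k : V → ℕ // ProperCol G.edgeSet k} ≃ {k : W → ℕ // ProperCol G'.edgeSet k},
      ∀ k, colorContent (e k).1 = colorContent k.1 := by
  have hd (d : ℕ →₀ ℕ) : Nonempty
      ({k : {k : V → ℕ // ProperCol G.edgeSet k} // colorContent k.1 = d} ≃
        {k : {k : W → ℕ // ProperCol G'.edgeSet k} // colorContent k.1 = d}) := by
    rw [← Finite.card_eq]
    have := congrFun h d
    rwa [csf_apply, csf_apply, Nat.cast_inj] at this
  let e := fun d ↦ (hd d).some
  exact ⟨(Equiv.sigmaFiberEquiv fun k : {k : V → ℕ // ProperCol G.edgeSet k} ↦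
      colorContent k.1).symm.trans ((Equiv.sigmaCongrRight e).trans (Equiv.sigmaFiberEquiv _)),
    fun k ↦ (e (colorContent k.1) ⟨k, rfl⟩).2⟩

theorem card_eq_of_csf_eq {G : SimpleGraph V} {G' : SimpleGraph W} (h : csf G = csf G') :
    Nat.card V = Nat.card W := by
  obtain ⟨e, he⟩ := exists_equiv_of_csf_eq h
  obtain ⟨n, ⟨f⟩⟩ := Finite.exists_equiv_fin V
  let k : {k : V → ℕ // ProperCol G.edgeSet k} :=
    ⟨fun v ↦ f v, fun u v huv huv' ↦ G.ne_of_adj huv (f.injective (Fin.ext huv'))⟩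
  rw [← sum_colorContent_support k.1, ← he k, sum_colorContent_support]

theorem forall_lt_and_ncard_iff_colorContent (k : V → ℕ) (a b i : ℕ) :
    ((∀ v, k v < b) ∧ {v | k v < a}.ncard = i) ↔
      (∀ j, b ≤ j → colorContent k j = 0) ∧ ∑ j ∈ Finset.range a, colorContent k j = i := by
  refine and_congr ⟨fun hk j hj ↦ ?_, fun hk v ↦ ?_⟩ ?_
  · by_contra hj'
    obtain ⟨v, rfl⟩ := (colorContent_ne_zero_iff k j).1 hj'
    exact (hk v).not_ge hj
  · by_contra hv
    exact (colorContent_ne_zero_iff k (k v)).2 ⟨v, rfl⟩ (hk _ (not_lt.1 hv))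
  · simp [sum_colorContent]

/-- The proper colorings with `a + t` colors using the first `a` colors exactly `i` times. -/
abbrev SplitColoring (G : SimpleGraph V) (a t i : ℕ) : Type _ :=
  {k : V → ℕ // ProperCol G.edgeSet k ∧ (∀ v, k v < a + t) ∧ {v | k v < a}.ncard = i}

theorem card_splitColoring_eq_of_csf_eq {G : SimpleGraph V} {G' : SimpleGraph W}
    (h : csf G = csf G') (a t i : ℕ) :
    Nat.card (SplitColoring G a t i) = Nat.card (SplitColoring G' a t i) := by
  obtain ⟨e, he⟩ := exists_equiv_of_csf_eq h
  refine Nat.card_congr <| (Equiv.subtypeSubtypeEquivSubtypeInter _ _).symm.trans <|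
    (e.subtypeEquiv fun k ↦ ?_).trans (Equiv.subtypeSubtypeEquivSubtypeInter _ _)
  rw [forall_lt_and_ncard_iff_colorContent, forall_lt_and_ncard_iff_colorContent, he]

end Content

section Split

variable {V : Type*}

/-- Gluing colorings of `S` and of its complement with disjoint sets of colors. -/
def splitColoringFiberEquiv [Finite V] (G : SimpleGraph V) (a t i : ℕ) (S : Set V)
    [DecidablePred (· ∈ S)] (hS : S.ncard = i) :
    {k : SplitColoring G a t i // {v | k.1 v < a} = S} ≃
      (G.induce S).Coloring (Fin a) × (G.induce Sᶜ).Coloring (Fin t) where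
  toFun k :=
    have hk (v : V) : k.1.1 v < a ↔ v ∈ S := Set.ext_iff.1 k.2 v
    (Coloring.mk (fun v ↦ ⟨k.1.1 v, (hk v).2 v.2⟩) fun {u v} huv h ↦
        k.1.2.1 u v huv (congrArg Fin.val h),
      Coloring.mk (fun v ↦ ⟨k.1.1 v - a, by
          have := k.1.2.2.1 v
          have := mt (hk v).1 v.2
          omega⟩) fun {u v} huv h ↦
        k.1.2.1 u v huv (by
          have := mt (hk v).1 v.2
          have := mt (hk u).1 u.2
          have := congrArg Fin.val h
          dsimp only at this
          omega))
  invFun c :=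
    have hlt (v : V) : (if h : v ∈ S then (c.1 ⟨v, h⟩ : ℕ) else a + c.2 ⟨v, h⟩) < a ↔ v ∈ S := by
      split_ifs with h <;> simp [h]
    ⟨⟨fun v ↦ if h : v ∈ S then c.1 ⟨v, h⟩ else a + c.2 ⟨v, h⟩, by
      intro u v huv
      by_cases hu : u ∈ S <;> by_cases hv : v ∈ S
      · simpa [hu, hv, Fin.ext_iff] using c.1.valid (v := ⟨u, hu⟩) (w := ⟨v, hv⟩) huv
      · simp only [hu, hv, dite_true, dite_false]; omega
      · simp only [hu, hv, dite_true, dite_false]; omega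
      · simpa [hu, hv, Fin.ext_iff] using c.2.valid (v := ⟨u, hu⟩) (w := ⟨v, hv⟩) huv,
      fun v ↦ by
        dsimp only
        split_ifs with h <;> omega,
      by simpa only [hlt, Set.ofPred_mem_eq] using hS⟩, by ext v; exact hlt v⟩
  left_inv k := by
    have hk (v : V) : k.1.1 v < a ↔ v ∈ S := Set.ext_iff.1 k.2 v
    ext v
    by_cases hv : v ∈ S
    · simp [hv, Coloring.mk]
    · have := mt (hk v).1 hv
      simp [hv, Coloring.mk]
      omega
  right_inv c := by
    refine Prod.ext ?_ ?_
    · ext ⟨v, hv⟩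
      simp [Coloring.mk]
    · ext ⟨v, hv⟩
      have hv' : v ∉ S := hv
      simp [Coloring.mk, hv']

open Classical in
theorem card_splitColoring [Fintype V] (G : SimpleGraph V) (a t i : ℕ) :
    Nat.card (SplitColoring G a t i) = ∑ S : Set V with S.ncard = i,
      Nat.card ((G.induce S).Coloring (Fin a)) * Nat.card ((G.induce Sᶜ).Coloring (Fin t)) := by
  have (S : Set V) : Finite {k : SplitColoring G a t i // {v | k.1 v < a} = S} := by
    by_cases hS : S.ncard = i
    · exact Finite.of_equiv _ (splitColoringFiberEquiv G a t i S hS).symm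
    · exact Finite.of_injective (β := Empty) (fun k ↦ (hS (by rw [← k.2, k.1.2.2.2])).elim)
        (fun k ↦ (hS (by rw [← k.2, k.1.2.2.2])).elim)
  rw [← Nat.card_congr (Equiv.sigmaFiberEquiv fun k : SplitColoring G a t i ↦ {v | k.1 v < a}),
    Nat.card_sigma, Finset.sum_filter]
  refine Finset.sum_congr rfl fun S _ ↦ ?_
  split_ifs with hS
  · rw [Nat.card_congr (splitColoringFiberEquiv G a t i S hS), Nat.card_prod]
  · rw [Nat.card_eq_zero]
    exact Or.inl ⟨fun k ↦ hS (by rw [← k.2, k.1.2.2.2])⟩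

end Split

section Polynomials

open Polynomial

/-- The chromatic polynomial of a forest with `n` vertices and `c` components. -/
noncomputable def forestPoly (n c : ℕ) : ℤ[X] := X ^ c * (X - 1) ^ (n - c)

theorem IsAcyclic.eval_forestPoly {V : Type*} [Finite V] {G : SimpleGraph V} (hG : G.IsAcyclic)
    {a : ℕ} (ha : 1 ≤ a) :
    (forestPoly (Nat.card V) (Nat.card G.ConnectedComponent)).eval (a : ℤ) =
      Nat.card (G.Coloring (Fin a)) := by
  simp [forestPoly, hG.card_coloring, Nat.cast_sub ha]

theorem card_connectedComponent_eq_one_iff {V : Type*} (G : SimpleGraph V) :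
    Nat.card G.ConnectedComponent = 1 ↔ G.Connected := by
  rw [Nat.card_eq_one_iff_unique, connected_iff]
  refine and_congr ⟨fun h u v ↦ ConnectedComponent.exact (Subsingleton.elim _ _),
    fun h ↦ h.subsingleton_connectedComponent⟩ ⟨fun ⟨c⟩ ↦ ?_, fun ⟨v⟩ ↦ ⟨G.connectedComponentMk v⟩⟩
  exact c.nonempty_supp.to_subtype.map Subtype.val

theorem coeff_one_forestPoly (n c : ℕ) (h : c = 0 → n = 0) :
    (forestPoly n c).coeff 1 = if c = 1 then (-1) ^ (n - 1) else 0 := by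
  match c with
  | 0 => simp [forestPoly, h rfl, coeff_one]
  | 1 =>
    have : (X ^ 1 * (X - 1) ^ (n - 1) : ℤ[X]).coeff (0 + 1) = (-1) ^ (n - 1) := by
      rw [pow_one, coeff_X_mul, coeff_zero_eq_eval_zero]
      simp
    simpa [forestPoly] using this
  | c + 2 =>
    rw [forestPoly, coeff_X_pow_mul']
    simp

variable {V : Type*} [Fintype V]

/-- The generating function, by number of components of the complement, of the subtrees of `G`
with `i` vertices. -/
noncomputable def subtreePoly (G : SimpleGraph V) (i : ℕ) : ℤ[X] :=
  open Classical in ∑ S : Set V with S.ncard = i ∧ (G.induce S).Connected,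
    X ^ Nat.card (G.induce Sᶜ).ConnectedComponent

open Classical in
/-- The number of ways to choose a subtree with `i` vertices and a proper coloring of its
complement with `t` colors. -/
noncomputable def subtreeColoringCount (G : SimpleGraph V) (i t : ℕ) : ℕ :=
  ∑ S : Set V with S.ncard = i ∧ (G.induce S).Connected, Nat.card ((G.induce Sᶜ).Coloring (Fin t))

open Classical in
/-- The polynomial in `a` counting the split colorings of a forest. -/
noncomputable def splitPoly (G : SimpleGraph V) (i t : ℕ) : ℤ[X] :=
  ∑ S : Set V with S.ncard = i, forestPoly i (Nat.card (G.induce S).ConnectedComponent) *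
    C (Nat.card ((G.induce Sᶜ).Coloring (Fin t)) : ℤ)

theorem IsAcyclic.eval_splitPoly {G : SimpleGraph V} (hG : G.IsAcyclic) (i t : ℕ) {a : ℕ}
    (ha : 1 ≤ a) : (splitPoly G i t).eval (a : ℤ) = Nat.card (SplitColoring G a t i) := by
  classical
  rw [card_splitColoring, splitPoly, eval_finsetSum, Nat.cast_sum]
  refine Finset.sum_congr rfl fun S hS ↦ ?_
  rw [Finset.mem_filter] at hS
  rw [eval_mul, eval_C, Nat.cast_mul, ← (hG.induce S).eval_forestPoly ha, Nat.card_coe_set_eq, hS.2]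

theorem coeff_one_splitPoly (G : SimpleGraph V) (i t : ℕ) :
    (splitPoly G i t).coeff 1 = (-1) ^ (i - 1) * subtreeColoringCount G i t := by
  classical
  rw [splitPoly, finsetSum_coeff, subtreeColoringCount, Nat.cast_sum, Finset.mul_sum,
    ← Finset.filter_filter, Finset.sum_filter (fun S : Set V ↦ (G.induce S).Connected)]
  refine Finset.sum_congr rfl fun S hS ↦ ?_
  rw [Finset.mem_filter] at hS
  rw [coeff_mul_C, coeff_one_forestPoly, ite_mul, zero_mul]
  · simp only [card_connectedComponent_eq_one_iff]
  · intro h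
    rw [Finite.card_eq_zero_iff] at h
    rw [← hS.2, ← Nat.card_coe_set_eq, Finite.card_eq_zero_iff]
    exact ⟨fun v ↦ h.false ((G.induce S).connectedComponentMk v)⟩

theorem IsAcyclic.eval_subtreePoly {G : SimpleGraph V} (hG : G.IsAcyclic) (i : ℕ) {t : ℕ}
    (ht : 1 ≤ t) :
    (t : ℚ) ^ (Nat.card V - i) * aeval (1 + 1 / (t : ℚ)) (subtreePoly G i) =
      subtreeColoringCount G i (t + 1) := by
  classical
  have ht' : (t : ℚ) ≠ 0 := by positivity
  rw [subtreePoly, subtreeColoringCount, map_sum, Nat.cast_sum, Finset.mul_sum]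
  refine Finset.sum_congr rfl fun S hS ↦ ?_
  rw [Finset.mem_filter] at hS
  have hS' : Nat.card (Sᶜ : Set V) = Nat.card V - i := by
    rw [Nat.card_coe_set_eq, Set.ncard_compl, hS.2.1]
  have hle := (G.induce Sᶜ).card_connectedComponent_le
  rw [hS'] at hle
  rw [(hG.induce Sᶜ).card_coloring, hS', ← Nat.sub_add_cancel hle, pow_add]
  simp only [map_pow, aeval_X, Nat.add_sub_cancel]
  push_cast
  rw [mul_assoc, ← mul_pow, mul_add, mul_one_div_cancel ht', mul_one, mul_comm]

theorem subtreePoly_eq_of_csf_eq {W : Type*} [Fintype W] {G : SimpleGraph V} {G' : SimpleGraph W}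
    (hG : G.IsAcyclic) (hG' : G'.IsAcyclic) (h : csf G = csf G') (i : ℕ) :
    subtreePoly G i = subtreePoly G' i := by
  have hsplit (t : ℕ) : splitPoly G i t = splitPoly G' i t := by
    refine eq_of_infinite_eval_eq _ _ <| (Set.infinite_range_of_injective
      (f := fun n : ℕ ↦ ((n + 1 : ℕ) : ℤ)) fun m n h ↦ by simpa using h).mono ?_
    rintro _ ⟨n, rfl⟩
    simp only [Set.mem_ofPred_eq]
    rw [hG.eval_splitPoly i t n.succ_pos, hG'.eval_splitPoly i t n.succ_pos,
      card_splitColoring_eq_of_csf_eq h]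
  have hcount (t : ℕ) : subtreeColoringCount G i t = subtreeColoringCount G' i t := by
    have := congrArg (coeff · 1) (hsplit t)
    simpa [coeff_one_splitPoly] using this
  refine Polynomial.map_injective (Int.castRingHom ℚ) Int.cast_injective <|
    eq_of_infinite_eval_eq _ _ <| (Set.infinite_range_of_injective
      (f := fun n : ℕ ↦ 1 + 1 / ((n + 1 : ℕ) : ℚ)) fun m n h ↦ by simpa using h).mono ?_
  rintro _ ⟨n, rfl⟩
  have h1 := hG.eval_subtreePoly i n.succ_pos
  rw [hcount, ← hG'.eval_subtreePoly i n.succ_pos, card_eq_of_csf_eq h] at h1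
  have h2 := mul_left_cancel₀ (by positivity) h1
  simpa [aeval_def, eval_map] using h2

theorem FPoly_eq_sum (G : SimpleGraph V) {n : ℕ} (hn : Nat.card V = n) :
    FPoly G = ∑ i ∈ Finset.range (n + 1), MvPolynomial.X 0 ^ i *
      aeval (MvPolynomial.X 1 : MvPolynomial (Fin 2) ℤ) (subtreePoly G i) := by
  classical
  subst hn
  rw [FPoly, finsum_mem_eq_finite_toFinset_sum _ (Set.toFinite _),
    ← Finset.sum_fiberwise_of_maps_to (g := Set.ncard) (t := Finset.range (Nat.card V + 1))]
  · refine Finset.sum_congr rfl fun i _ ↦ ?_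
    rw [subtreePoly, map_sum, Finset.mul_sum]
    refine Finset.sum_congr ?_ fun S hS ↦ ?_
    · ext S
      simp [and_comm]
    · simp [(Finset.mem_filter.1 hS).2.1]
  · intro S _
    rw [Finset.mem_range, Nat.lt_succ_iff, ← Set.ncard_univ]
    exact Set.ncard_le_ncard (Set.subset_univ S)

end Polynomials

end SimpleGraph

/-- the subtree polynomial `F_T(x,y)` is determined by the chromatic
symmetric function: trees with equal `X` have equal `F`. -/
theorem stmt16 {V W : Type*} [Finite V] [Finite W]
    (T : SimpleGraph V) (T' : SimpleGraph W)
    (hcT : T.Connected) (haT : T.IsAcyclic)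
    (hcT' : T'.Connected) (haT' : T'.IsAcyclic)
    (h : csf T = csf T') : FPoly T = FPoly T' := by
  cases nonempty_fintype V
  cases nonempty_fintype W
  rw [T.FPoly_eq_sum (card_eq_of_csf_eq h), T'.FPoly_eq_sum rfl]
  simp only [subtreePoly_eq_of_csf_eq haT haT' h]
end
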